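/- arXiv:1505.00870 — 10 statements merged into one kernel-verified Lean document; each statement's English description precedes it below -/
import Mathlib

section
/- Let z ∈ ℝⁿ, let Q be a permutation matrix such that Q|z| is in nonincreasing order, and let sign(z) ∈ {−1, 1}ⁿ be the componentwise sign vector of z (with the convention sign(0) := 1). Then P_{B(w,ε)}(z) = sign(z) ⊙ Qᵀ P_{L(w,ε) ∩ T}(Q|z|), where ⊙ denotes the componentwise product of vectors. -/
open Finset

/-- The monotone nonnegative cone `T = {x : x₁ ≥ x₂ ≥ ⋯ ≥ xₙ ≥ 0}`. -/
def coneT (n : ℕ) : Set (Fin n → ℝ) := {x | Antitone x ∧ ∀ i, 0 ≤ x i}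

/-- Euclidean inner product on `Fin n → ℝ`. -/
def dot {n : ℕ} (x y : Fin n → ℝ) : ℝ := ∑ i, x i * y i

/-- `x` is the Euclidean projection of `z` onto `C` (minimizer of the distance to `z` over `C`). -/
def IsProjOn {n : ℕ} (C : Set (Fin n → ℝ)) (z x : Fin n → ℝ) : Prop :=
  x ∈ C ∧ ∀ y ∈ C, ∑ i, (x i - z i) ^ 2 ≤ ∑ i, (y i - z i) ^ 2

/-- The ordered weighted ℓ₁ (OWL) norm `Ω_w(x) = ∑ᵢ wᵢ |x|_[i]`,
where `|x|_[i]` is the i-th largest entry of `(|x₁|, …, |xₙ|)`. -/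
noncomputable def owl {n : ℕ} (w x : Fin n → ℝ) : ℝ :=
  ∑ i : Fin n, w i * |x ((Tuple.sort fun j => |x j|) i.rev)|

/-- The closed OWL norm ball `B(w, ε)`. -/
def owlBall {n : ℕ} (w : Fin n → ℝ) (ε : ℝ) : Set (Fin n → ℝ) := {x | owl w x ≤ ε}

/-- The half-space `L(w, ε) = {x : ⟨w, x⟩ ≤ ε}`. -/
def halfSpace {n : ℕ} (w : Fin n → ℝ) (ε : ℝ) : Set (Fin n → ℝ) := {x | dot w x ≤ ε}

/-- The hyperplane `H(w, ε) = {x : ⟨w, x⟩ = ε}`. -/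
def hyperplane {n : ℕ} (w : Fin n → ℝ) (ε : ℝ) : Set (Fin n → ℝ) := {x | dot w x = ε}

/-- `P ∈ 𝒫ₙ`: a partition of `{0, …, n-1}` all of whose blocks are intervals. -/
def IsIntervalPartition {n : ℕ} (P : Finset (Finset (Fin n))) : Prop :=
  (∀ G ∈ P, G.Nonempty) ∧
  (∀ i : Fin n, ∃! G, G ∈ P ∧ i ∈ G) ∧
  (∀ G ∈ P, ∀ i ∈ G, ∀ k ∈ G, ∀ j : Fin n, i ≤ j → j ≤ k → j ∈ G)

/-- `P ≼ Q`: every block of `P` is contained in some block of `Q`. -/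
def Refines {n : ℕ} (P Q : Finset (Finset (Fin n))) : Prop :=
  ∀ G ∈ P, ∃ H ∈ Q, G ⊆ H

/-- `i` and `j` lie in a common block of `P`. -/
def SameBlock {n : ℕ} (P : Finset (Finset (Fin n))) (i j : Fin n) : Prop :=
  ∃ G ∈ P, i ∈ G ∧ j ∈ G

/-- `P = 𝒢(z)`: the partition of indices into maximal intervals of nondecreasing
components of `z`; consecutive indices lie in the same block iff `zᵢ ≤ zᵢ₊₁`. -/
def IsGroupPartition {n : ℕ} (z : Fin n → ℝ) (P : Finset (Finset (Fin n))) : Prop :=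
  IsIntervalPartition P ∧
  ∀ (i : Fin n) (h : i.val + 1 < n),
    (SameBlock P i ⟨i.val + 1, h⟩ ↔ z i ≤ z ⟨i.val + 1, h⟩)

/-- `v = z_P`: the vector obtained from `z` by averaging over the blocks of `P`. -/
def IsAvg {n : ℕ} (P : Finset (Finset (Fin n))) (z v : Fin n → ℝ) : Prop :=
  ∀ G ∈ P, ∀ i ∈ G, v i = (∑ k ∈ G, z k) / (G.card : ℝ)

/-- `(lam, v)` is a KKT pair for `x` in the reduced problem
`min ½‖x − z‖² s.t. ⟨w, x⟩ = ε, x ∈ T`. -/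
def IsKKT {n : ℕ} (z w : Fin n → ℝ) (ε : ℝ) (x : Fin n → ℝ) (lam : ℝ)
    (v : Fin n → ℝ) : Prop :=
  0 < lam ∧ (∀ i, 0 ≤ v i) ∧ x ∈ coneT n ∧
  (∀ (i : Fin n) (h : i.val + 1 < n), v i * (x i - x ⟨i.val + 1, h⟩) = 0) ∧
  (∀ h : 0 < n, v ⟨n - 1, Nat.sub_lt h one_pos⟩ * x ⟨n - 1, Nat.sub_lt h one_pos⟩ = 0) ∧
  (∀ i : Fin n, x i = z i - lam * w i + v i -
    (if _ : i.val = 0 then 0 else v ⟨i.val - 1, lt_of_le_of_lt (Nat.sub_le _ _) i.isLt⟩)) ∧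
  dot w x = ε

/-- The last index `n - 1` of `Fin n`. -/
def lastIdx {n : ℕ} (hn : 0 < n) : Fin n := ⟨n - 1, Nat.sub_lt hn one_pos⟩

/-- `r = min {(zᵢ − zᵢ₊₁)/(wᵢ − wᵢ₊₁)}` in the extended reals, with `0/0 = ∞`, `a/0 = ∞`. -/
noncomputable def rmin {n : ℕ} (z w : Fin n → ℝ) : EReal :=
  ⨅ i : Fin n,
    if h : i.val + 1 < n then
      (if w i - w ⟨i.val + 1, h⟩ = 0 then (⊤ : EReal)
       else (((z i - z ⟨i.val + 1, h⟩) / (w i - w ⟨i.val + 1, h⟩) : ℝ) : EReal))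
    else ⊤

/-- `λ₁ = (⟨z, w⟩ − ε)/‖w‖²`. -/
noncomputable def lam1 {n : ℕ} (z w : Fin n → ℝ) (ε : ℝ) : ℝ :=
  (dot z w - ε) / dot w w

/-- `λ₀ = ((Σ_{i : zᵢ > zₙ} zᵢwᵢ) − ε)/(Σ_{i : zᵢ > zₙ} wᵢ²)`. -/
noncomputable def lam0 {n : ℕ} (hn : 0 < n) (z w : Fin n → ℝ) (ε : ℝ) : ℝ :=
  ((∑ i ∈ Finset.univ.filter (fun i => z (lastIdx hn) < z i), z i * w i) - ε) /
    (∑ i ∈ Finset.univ.filter (fun i => z (lastIdx hn) < z i), w i ^ 2)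

/-- `n' = min({k : z_k − λ₀ w_k < 0} ∪ {n+1})`, with 1-based indexing `k = i + 1`. -/
noncomputable def nprime {n : ℕ} (z w : Fin n → ℝ) (l0 : ℝ) : ℕ :=
  sInf {k | k = n + 1 ∨ ∃ i : Fin n, i.val + 1 = k ∧ z i - l0 * w i < 0}

/-- Componentwise sign, with the convention `sgn 0 = 1`. -/
noncomputable def sgn (t : ℝ) : ℝ := if t < 0 then -1 else 1

/-- The simplex `Δ(κ, n) = {x : x ≥ 0, Σ xᵢ = κ}`. -/
def simplexSet (κ : ℝ) (n : ℕ) : Set (Fin n → ℝ) :=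
  {x | (∀ i, 0 ≤ x i) ∧ ∑ i, x i = κ}


theorem sgn_mul_self (t : ℝ) : sgn t * sgn t = 1 := by
  unfold sgn; split_ifs <;> norm_num

theorem sgn_mul_abs (t : ℝ) : sgn t * |t| = t := by
  unfold sgn
  split_ifs with h
  · rw [abs_of_neg h]; ring
  · rw [abs_of_nonneg (not_lt.mp h), one_mul]

theorem abs_sgn (t : ℝ) : |sgn t| = 1 := by
  unfold sgn; split_ifs <;> norm_num

/-- The nonincreasing rearrangement of `|x|` is nonincreasing. -/
theorem antitone_abs_sort_rev {n : ℕ} (x : Fin n → ℝ) :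
    Antitone fun i : Fin n => |x (Tuple.sort (fun j => |x j|) i.rev)| := fun _ _ h =>
  Tuple.monotone_sort (fun j => |x j|) (Fin.rev_le_rev.mpr h)

/-- The OWL norm of `x` is `⟨w, q⟩` whenever `q` is a nonincreasing rearrangement of `|x|`. -/
theorem owl_eq_dot {n : ℕ} (w x q : Fin n → ℝ) (τ : Equiv.Perm (Fin n)) (hq : Antitone q)
    (hx : ∀ i, |x i| = q (τ i)) : owl w x = dot w q := by
  have hmono : Monotone ((fun j => |x j|) ∘ (Fin.revPerm.trans τ.symm : Equiv.Perm (Fin n))) := by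
    intro i j h
    simpa [hx] using hq (Fin.rev_le_rev.mpr h)
  have key := Tuple.comp_sort_eq_comp_iff_monotone.mpr hmono
  unfold owl dot
  refine sum_congr rfl fun i _ => ?_
  have := congrFun key i.rev
  simp only [Function.comp_apply, Equiv.trans_apply, Fin.revPerm_apply, Fin.rev_rev] at this
  rw [← this, hx, Equiv.apply_symm_apply]

/-- Rearranging `|y|` and `|z|` into nonincreasing order does not increase their distance. -/
theorem sum_sq_sub_sort_le {n : ℕ} (y z : Fin n → ℝ) (σ : Equiv.Perm (Fin n))
    (hsort : Antitone fun i => |z (σ i)|) :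
    ∑ i : Fin n, (|y (Tuple.sort (fun j => |y j|) i.rev)| - |z (σ i)|) ^ 2
      ≤ ∑ i, (y i - z i) ^ 2 := by
  set τ : Equiv.Perm (Fin n) := Fin.revPerm.trans (Tuple.sort fun j => |y j|)
  change ∑ i : Fin n, (|y (τ i)| - |z (σ i)|) ^ 2 ≤ _
  have hmv : Monovary (fun i => |y (τ i)|) (fun i => |z (σ i)|) :=
    (antitone_abs_sort_rev y).monovary hsort
  have hrearr : ∑ i, |y i| * |z i| ≤ ∑ i, |y (τ i)| * |z (σ i)| := by
    have h := hmv.sum_comp_perm_mul_le_sum_mul (σ := σ.trans τ.symm)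
    simp only [Equiv.trans_apply, Equiv.apply_symm_apply] at h
    rwa [Equiv.sum_comp σ fun i => |y i| * |z i|] at h
  have hyz : ∑ i, y i * z i ≤ ∑ i, |y i| * |z i| :=
    sum_le_sum fun i _ => (le_abs_self _).trans_eq (abs_mul _ _)
  have hy : ∑ i, y (τ i) ^ 2 = ∑ i, y i ^ 2 := Equiv.sum_comp τ fun i => y i ^ 2
  have hz : ∑ i, z (σ i) ^ 2 = ∑ i, z i ^ 2 := Equiv.sum_comp σ fun i => z i ^ 2
  simp only [sub_sq, sum_add_distrib, sum_sub_distrib, sq_abs, mul_assoc, ← mul_sum, hy, hz]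
  linarith

/-- Problem Reduction. If `Q` is a permutation matrix sorting `|z|`
into nonincreasing order, then
`P_{B(w,ε)}(z) = sign(z) ⊙ Qᵀ P_{L(w,ε) ∩ T}(Q|z|)`. -/
theorem owl_ball_proj_reduction {n : ℕ} (hn : 1 ≤ n) (ε : ℝ) (hε : 0 < ε)
    (w : Fin n → ℝ) (hw_anti : Antitone w) (hw_nonneg : ∀ i, 0 ≤ w i) (hw_ne : w ≠ 0)
    (z : Fin n → ℝ)
    (Q : Matrix (Fin n) (Fin n) ℝ) (σ : Equiv.Perm (Fin n)) (hQ : Q = σ.permMatrix ℝ)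
    (hsort : Antitone (Q.mulVec fun i => |z i|))
    (p : Fin n → ℝ)
    (hp : IsProjOn (halfSpace w ε ∩ coneT n) (Q.mulVec fun i => |z i|) p) :
    IsProjOn (owlBall w ε) z (fun i => sgn (z i) * Q.transpose.mulVec p i) := by
  subst hQ
  have hmul (v : Fin n → ℝ) : (σ.permMatrix ℝ).mulVec v = v ∘ σ := Matrix.permMatrix_mulVec σ
  have htr (v : Fin n → ℝ) (i : Fin n) : (σ.permMatrix ℝ).transpose.mulVec v i = v (σ.symm i) := by
    rw [Matrix.transpose_permMatrix, Matrix.permMatrix_mulVec]; rfl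
  simp only [htr]
  rw [hmul] at hsort hp
  obtain ⟨⟨hpw, hpa, hp0⟩, hmin⟩ := hp
  refine ⟨?_, fun y hy => ?_⟩
  · have h := owl_eq_dot w (fun i => sgn (z i) * p (σ.symm i)) p σ.symm hpa fun i => by
      rw [abs_mul, abs_sgn, one_mul, abs_of_nonneg (hp0 _)]
    exact h.trans_le hpw
  · have hdist : ∑ i, (sgn (z i) * p (σ.symm i) - z i) ^ 2 = ∑ i, (p i - |z (σ i)|) ^ 2 := by
      rw [← Equiv.sum_comp σ]
      refine sum_congr rfl fun i _ => ?_
      rw [Equiv.symm_apply_apply]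
      nth_rewrite 2 [← sgn_mul_abs (z (σ i))]
      rw [← mul_sub, mul_pow, sq, sgn_mul_self, one_mul]
    rw [hdist]
    exact (hmin _ ⟨hy, antitone_abs_sort_rev y, fun _ => abs_nonneg _⟩).trans
      (sum_sq_sub_sort_le y z σ hsort)
end

section
/- If z ∈ T, then P_{B(w,ε)}(z) = P_{L(w,ε) ∩ T}(z); that is, for a componentwise nonincreasing nonnegative input, projecting onto the OWL ball coincides with projecting onto the intersection of the half-space L(w,ε) with the monotone nonnegative cone T. -/
open Finset

/-- The permutation listing the indices of `x` by nonincreasing absolute value. -/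
noncomputable def absSortPerm {n : ℕ} (x : Fin n → ℝ) : Equiv.Perm (Fin n) :=
  Fin.revPerm.trans (Tuple.sort fun j => |x j|)

/-- The nonincreasing rearrangement of `|x|`. -/
noncomputable def absSort {n : ℕ} (x : Fin n → ℝ) : Fin n → ℝ :=
  fun i => |x (absSortPerm x i)|

lemma owl_eq_dot_absSort {n : ℕ} (w x : Fin n → ℝ) : owl w x = dot w (absSort x) := rfl

lemma absSort_mem_coneT {n : ℕ} (x : Fin n → ℝ) : absSort x ∈ coneT n :=
  ⟨fun _ _ h => Tuple.monotone_sort (fun j => |x j|) (Fin.rev_le_rev.mpr h),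
    fun _ => abs_nonneg _⟩

lemma dot_comp_perm_le_of_antitone {n : ℕ} {v u : Fin n → ℝ} (hv : Antitone v)
    (hu : Antitone u) (σ : Equiv.Perm (Fin n)) : dot v (u ∘ σ) ≤ dot v u :=
  (hv.monovary hu).sum_mul_comp_perm_le_sum_mul

lemma dot_abs_comp_perm_le_owl {n : ℕ} {v : Fin n → ℝ} (hv : Antitone v) (x : Fin n → ℝ)
    (σ : Equiv.Perm (Fin n)) : dot v (fun i => |x (σ i)|) ≤ owl v x := by
  have h := dot_comp_perm_le_of_antitone hv (absSort_mem_coneT x).1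
    (σ.trans (absSortPerm x).symm)
  have hcomp : absSort x ∘ σ.trans (absSortPerm x).symm = fun i => |x (σ i)| := by
    ext i
    simp [absSort]
  rwa [hcomp] at h

lemma owl_eq_dot_of_mem_coneT {n : ℕ} {w u : Fin n → ℝ} (hw : Antitone w)
    (hu : u ∈ coneT n) : owl w u = dot w u := by
  have habs : (fun i => |u i|) = u := funext fun i => abs_of_nonneg (hu.2 i)
  apply le_antisymm
  · have hsort : absSort u = u ∘ absSortPerm u := funext fun i => abs_of_nonneg (hu.2 _)
    rw [owl_eq_dot_absSort, hsort]
    exact dot_comp_perm_le_of_antitone hw hu.1 _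
  · simpa [habs] using dot_abs_comp_perm_le_owl hw u (Equiv.refl _)

lemma owl_midpoint_le {n : ℕ} {w : Fin n → ℝ} (hw : Antitone w) (hw0 : ∀ i, 0 ≤ w i)
    (x y : Fin n → ℝ) : owl w (fun i => (x i + y i) / 2) ≤ (owl w x + owl w y) / 2 := by
  set m : Fin n → ℝ := fun i => (x i + y i) / 2 with hm
  have hx := dot_abs_comp_perm_le_owl hw x (absSortPerm m)
  have hy := dot_abs_comp_perm_le_owl hw y (absSortPerm m)
  have h : owl w m ≤ (dot w (fun i => |x (absSortPerm m i)|) +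
      dot w (fun i => |y (absSortPerm m i)|)) / 2 := by
    rw [owl_eq_dot_absSort, dot, dot, dot, ← Finset.sum_add_distrib, Finset.sum_div]
    refine Finset.sum_le_sum fun i _ => ?_
    have habs : absSort m i ≤ (|x (absSortPerm m i)| + |y (absSortPerm m i)|) / 2 := by
      rw [absSort, hm, abs_div, abs_two]
      gcongr
      exact abs_add_le _ _
    nlinarith [mul_le_mul_of_nonneg_left habs (hw0 i)]
  linarith

lemma sum_sq_absSort_sub_le {n : ℕ} {z : Fin n → ℝ} (hz : z ∈ coneT n) (x : Fin n → ℝ) :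
    ∑ i, (absSort x i - z i) ^ 2 ≤ ∑ i, (x i - z i) ^ 2 := by
  have expand (y : Fin n → ℝ) :
      ∑ i, (y i - z i) ^ 2 = ∑ i, y i ^ 2 - 2 * dot z y + ∑ i, z i ^ 2 := by
    rw [dot, Finset.mul_sum, ← Finset.sum_sub_distrib, ← Finset.sum_add_distrib]
    exact Finset.sum_congr rfl fun i _ => by ring
  have hsq : ∑ i, absSort x i ^ 2 = ∑ i, x i ^ 2 := by
    simp only [absSort, sq_abs]
    exact Equiv.sum_comp (absSortPerm x) fun i => x i ^ 2
  have habs : dot z x ≤ dot z fun i => |x i| :=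
    Finset.sum_le_sum fun i _ => mul_le_mul_of_nonneg_left (le_abs_self _) (hz.2 i)
  have hsort : dot z (fun i => |x i|) ≤ dot z (absSort x) :=
    dot_abs_comp_perm_le_owl hz.1 x (Equiv.refl _)
  rw [expand, expand, hsq]
  linarith

/-- A nearest point of a midpoint-closed set is unique. -/
lemma IsProjOn.eq_of_midpoint_mem {n : ℕ} {C : Set (Fin n → ℝ)} {z x y : Fin n → ℝ}
    (hx : IsProjOn C z x) (hm : (fun i => (x i + y i) / 2) ∈ C)
    (hy : ∑ i, (y i - z i) ^ 2 ≤ ∑ i, (x i - z i) ^ 2) : x = y := by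
  have hmid := hx.2 _ hm
  have hpar : ∑ i, ((x i + y i) / 2 - z i) ^ 2 =
      (∑ i, (x i - z i) ^ 2) / 2 + (∑ i, (y i - z i) ^ 2) / 2 -
        (∑ i, (x i - y i) ^ 2) / 4 := by
    rw [Finset.sum_div, Finset.sum_div, Finset.sum_div, ← Finset.sum_add_distrib,
      ← Finset.sum_sub_distrib]
    exact Finset.sum_congr rfl fun i _ => by ring
  have hnonneg : ∀ i ∈ Finset.univ, 0 ≤ (x i - y i) ^ 2 := fun i _ => sq_nonneg _
  have hzero : ∑ i, (x i - y i) ^ 2 = 0 :=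
    le_antisymm (by linarith) (Finset.sum_nonneg hnonneg)
  ext i
  have hi := (Finset.sum_eq_zero_iff_of_nonneg hnonneg).mp hzero i (Finset.mem_univ i)
  exact sub_eq_zero.mp (pow_eq_zero_iff two_ne_zero |>.mp hi)

/-- For `z ∈ T`, projecting onto the OWL ball coincides with projecting
onto `L(w,ε) ∩ T`. -/
theorem proj_owlBall_eq_proj_halfspace_inter_cone {n : ℕ} (hn : 1 ≤ n) (ε : ℝ)
    (hε : 0 < ε) (w : Fin n → ℝ) (hw_anti : Antitone w) (hw_nonneg : ∀ i, 0 ≤ w i)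
    (hw_ne : w ≠ 0) (z : Fin n → ℝ) (hz : z ∈ coneT n) (x : Fin n → ℝ) :
    IsProjOn (owlBall w ε) z x ↔ IsProjOn (halfSpace w ε ∩ coneT n) z x := by
  have hball {u : Fin n → ℝ} (hu : u ∈ coneT n) : u ∈ owlBall w ε ↔ u ∈ halfSpace w ε := by
    simp only [owlBall, halfSpace, Set.mem_ofPred_eq, owl_eq_dot_of_mem_coneT hw_anti hu]
  have hsort {y : Fin n → ℝ} (hy : y ∈ owlBall w ε) : absSort y ∈ halfSpace w ε := hy
  constructor
  · intro hx
    have hxT : x ∈ coneT n := by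
      have hu : owl w (absSort x) ≤ ε :=
        (hball (absSort_mem_coneT x)).mpr (hsort hx.1)
      have hx_le : owl w x ≤ ε := hx.1
      have hm : (fun i => (x i + absSort x i) / 2) ∈ owlBall w ε :=
        (owl_midpoint_le hw_anti hw_nonneg x (absSort x)).trans (by linarith)
      rw [hx.eq_of_midpoint_mem hm (sum_sq_absSort_sub_le hz x)]
      exact absSort_mem_coneT x
    exact ⟨⟨(hball hxT).mp hx.1, hxT⟩, fun y hy => hx.2 y ((hball hy.2).mpr hy.1)⟩
  · intro hx
    exact ⟨(hball hx.1.2).mpr hx.1.1, fun y hy =>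
      (hx.2 _ ⟨hsort hy, absSort_mem_coneT y⟩).trans (sum_sq_absSort_sub_le hz y)⟩
end

section
/- Let z, w ∈ T with w ≠ 0 and ⟨z, w⟩ > ε. A point x⁰ ∈ ℝⁿ is the unique minimizer of ½‖x − z‖² subject to ⟨w, x⟩ = ε and x ∈ T if and only if there exist a real λ* > 0 and a vector v* ∈ ℝⁿ with v* ≥ 0 such that: (i) x⁰ ∈ T; (ii) v*ᵢ(x⁰ᵢ − x⁰ᵢ₊₁) = 0 for 1 ≤ i < n and v*ₙ x⁰ₙ = 0; (iii) x⁰ᵢ = zᵢ − λ* wᵢ + v*ᵢ − v*ᵢ₋₁ for 1 ≤ i ≤ n, with the convention v*₀ := 0; and (iv) ⟨w, x⁰⟩ = ε. -/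
open Finset

/-- Extension of a vector on `Fin n` to `ℕ` by zero. -/
def extendZero {n : ℕ} (x : Fin n → ℝ) (i : ℕ) : ℝ := if h : i < n then x ⟨i, h⟩ else 0

/-- The successive decrement `xᵢ - xᵢ₊₁`, where the entry after the last one is `0`. -/
def drop {n : ℕ} (x : Fin n → ℝ) (i : Fin n) : ℝ := x i - extendZero x (i.val + 1)

/-- The previous entry `vᵢ₋₁`, with the entry before the first one equal to `0`. -/
def prevEntry {n : ℕ} (v : Fin n → ℝ) (i : Fin n) : ℝ :=
  if _ : i.val = 0 then 0 else v ⟨i.val - 1, lt_of_le_of_lt (Nat.sub_le _ _) i.isLt⟩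

lemma drop_nonneg {n : ℕ} {x : Fin n → ℝ} (hx : x ∈ coneT n) (i : Fin n) : 0 ≤ drop x i := by
  unfold drop extendZero
  split_ifs with h
  · exact sub_nonneg.2 (hx.1 (Fin.le_def.2 (Nat.le_succ _)))
  · simpa using hx.2 i

lemma sum_range_mul_sub (X W : ℕ → ℝ) (hW : W 0 = 0) (m : ℕ) :
    ∑ i ∈ range m, X i * (W (i + 1) - W i) =
      ∑ i ∈ range m, (X i - X (i + 1)) * W (i + 1) + X m * W m := by
  induction m with
  | zero => simp [hW]
  | succ m ih =>
    rw [sum_range_succ, sum_range_succ, ih]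
    ring

/-- Summation by parts for vectors indexed by `Fin n`. -/
lemma sum_mul_sub_prevEntry {n : ℕ} (x v : Fin n → ℝ) :
    ∑ i, x i * (v i - prevEntry v i) = ∑ i, drop x i * v i := by
  let W : ℕ → ℝ := fun i => if i = 0 then 0 else extendZero v (i - 1)
  have key := sum_range_mul_sub (extendZero x) W rfl n
  have hn : extendZero x n = 0 := by simp [extendZero]
  rw [hn, zero_mul, add_zero, ← Fin.sum_univ_eq_sum_range
    (fun i => extendZero x i * (W (i + 1) - W i)), ← Fin.sum_univ_eq_sum_range
    (fun i => (extendZero x i - extendZero x (i + 1)) * W (i + 1))] at key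
  have hx (i : Fin n) : extendZero x i = x i := by simp [extendZero]
  have hv (i : Fin n) : W (i + 1) = v i := by simp [W, extendZero]
  have hp (i : Fin n) : W i = prevEntry v i := by
    have := lt_of_le_of_lt (Nat.sub_le i.val 1) i.isLt
    by_cases h : i.val = 0 <;> simp [W, extendZero, prevEntry, h, this]
  simpa only [hx, hv, hp, drop] using key

lemma sum_Iic_sub_prevEntry {n : ℕ} (h : Fin n → ℝ) (k : Fin n) :
    ∑ i ∈ Iic k, h i - prevEntry (fun k => ∑ i ∈ Iic k, h i) k = h k := by
  unfold prevEntry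
  split_ifs with hk
  · have : Iic k = {k} := by
      ext i
      simp only [mem_Iic, mem_singleton, Fin.le_def, Fin.ext_iff]
      omega
    simp [this]
  · have : Iic k = insert k (Iic ⟨k.val - 1, lt_of_le_of_lt (Nat.sub_le _ _) k.isLt⟩) := by
      ext i
      simp only [mem_Iic, mem_insert, Fin.le_def, Fin.ext_iff]
      omega
    rw [this, sum_insert (by simp only [mem_Iic, Fin.le_def]; omega)]
    ring

lemma drop_mul_eq_zero_iff {n : ℕ} (hn : 0 < n) (x v : Fin n → ℝ) :
    (∀ i, drop x i * v i = 0) ↔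
      (∀ (i : Fin n) (h : i.val + 1 < n), v i * (x i - x ⟨i.val + 1, h⟩) = 0) ∧
      (∀ h : 0 < n, v ⟨n - 1, Nat.sub_lt h one_pos⟩ * x ⟨n - 1, Nat.sub_lt h one_pos⟩ = 0) := by
  constructor
  · refine fun H => ⟨fun i h => ?_, fun h => ?_⟩
    · simpa [drop, extendZero, h, mul_comm] using H i
    · have hlast : ¬ n - 1 + 1 < n := by omega
      simpa [drop, extendZero, hlast, mul_comm] using H ⟨n - 1, Nat.sub_lt h one_pos⟩
  · rintro ⟨H, Hlast⟩ i
    by_cases h : i.val + 1 < n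
    · simpa [drop, extendZero, h, mul_comm] using H i h
    · have hi : i = ⟨n - 1, Nat.sub_lt hn one_pos⟩ := Fin.ext (by simp only; omega)
      have := Hlast hn
      rw [← hi] at this
      simpa [drop, extendZero, h, mul_comm] using this

/-- The variational inequality for the projection onto a convex set. -/
lemma IsProjOn.sum_mul_sub_nonneg {n : ℕ} {C : Set (Fin n → ℝ)} (hC : Convex ℝ C)
    {z x : Fin n → ℝ} (hx : IsProjOn C z x) {y : Fin n → ℝ} (hy : y ∈ C) :
    0 ≤ ∑ i, (x i - z i) * (y i - x i) := by
  set a := ∑ i, (x i - z i) * (y i - x i)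
  set b := ∑ i, (y i - x i) ^ 2
  have hb : 0 ≤ b := sum_nonneg fun i _ => sq_nonneg _
  have key : ∀ t : ℝ, 0 ≤ t → t ≤ 1 → 0 ≤ 2 * t * a + t ^ 2 * b := by
    intro t ht ht1
    have h := hx.2 _ (hC.add_smul_sub_mem hx.1 hy ⟨ht, ht1⟩)
    have e : ∑ i, ((x + t • (y - x)) i - z i) ^ 2 =
        ∑ i, (x i - z i) ^ 2 + (2 * t * a + t ^ 2 * b) := by
      simp only [a, b, mul_sum, ← sum_add_distrib]
      refine sum_congr rfl fun i _ => ?_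
      simp only [Pi.add_apply, Pi.smul_apply, Pi.sub_apply, smul_eq_mul]
      ring
    linarith
  by_contra! ha
  have hba : 0 < b - a := by linarith
  have h := key (-a / (b - a)) (div_nonneg (by linarith) hba.le)
    ((div_le_one hba).2 (by linarith))
  have e : 2 * (-a / (b - a)) * a + (-a / (b - a)) ^ 2 * b =
      a ^ 2 * (2 * a - b) / (b - a) ^ 2 := by
    field_simp
    ring
  rw [e] at h
  have : a ^ 2 * (2 * a - b) / (b - a) ^ 2 < 0 :=
    div_neg_of_neg_of_pos (mul_neg_of_pos_of_neg (sq_pos_of_neg ha) (by linarith)) (by positivity)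
  linarith

lemma convex_hyperplane_inter_coneT {n : ℕ} (w : Fin n → ℝ) (ε : ℝ) :
    Convex ℝ (hyperplane w ε ∩ coneT n) := by
  rintro x ⟨hx, hxa, hxn⟩ y ⟨hy, hya, hyn⟩ a b ha hb hab
  refine ⟨?_, fun i j hij => ?_, fun i => ?_⟩
  · simp only [hyperplane, Set.mem_ofPred_eq, dot] at hx hy ⊢
    calc ∑ i, w i * (a • x + b • y) i = a * ∑ i, w i * x i + b * ∑ i, w i * y i := by
          simp only [mul_sum, ← sum_add_distrib]
          refine sum_congr rfl fun i _ => ?_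
          simp only [Pi.add_apply, Pi.smul_apply, smul_eq_mul]
          ring
      _ = ε := by rw [hx, hy, ← add_mul, hab, one_mul]
  · simp only [Pi.add_apply, Pi.smul_apply, smul_eq_mul]
    have := hxa hij
    have := hya hij
    gcongr
  · simp only [Pi.add_apply, Pi.smul_apply, smul_eq_mul]
    have := hxn i
    have := hyn i
    positivity

lemma sum_Iic_pos {n : ℕ} {w : Fin n → ℝ} (hw : w ∈ coneT n) (hw_ne : w ≠ 0) (k : Fin n) :
    0 < ∑ i ∈ Iic k, w i := by
  obtain ⟨j, hj⟩ := Function.ne_iff.1 hw_ne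
  let o : Fin n := ⟨0, k.pos⟩
  have ho : 0 < w o :=
    ((hw.2 j).lt_of_ne' hj).trans_le (hw.1 (Fin.le_def.2 (Nat.zero_le _)))
  exact sum_pos' (fun i _ => hw.2 i) ⟨o, mem_Iic.2 (Fin.le_def.2 (Nat.zero_le _)), ho⟩

lemma indicator_Iic_mem_coneT {n : ℕ} (k : Fin n) {c : ℝ} (hc : 0 ≤ c) :
    (fun i => if i ≤ k then c else 0) ∈ coneT n := by
  refine ⟨fun i j hij => ?_, fun i => ?_⟩
  · by_cases h : j ≤ k
    · simp [h, hij.trans h]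
    · simp only [h, if_false]
      split_ifs <;> simp [hc]
  · dsimp only
    split_ifs <;> simp [hc]

lemma sum_mul_indicator_Iic {n : ℕ} (y : Fin n → ℝ) (k : Fin n) (c : ℝ) :
    ∑ i, y i * (if i ≤ k then c else 0) = (∑ i ∈ Iic k, y i) * c := by
  simp only [mul_ite, mul_zero, sum_mul, ← sum_filter]
  congr 1
  ext i
  simp

lemma IsKKT.isProjOn {n : ℕ} (hn : 0 < n) {ε lam : ℝ} {z w x v : Fin n → ℝ}
    (h : IsKKT z w ε x lam v) : IsProjOn (hyperplane w ε ∩ coneT n) z x := by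
  obtain ⟨-, hv, hx, hc, hl, hs, he⟩ := h
  refine ⟨⟨he, hx⟩, fun y ⟨hyw, hy⟩ => ?_⟩
  have hstat (i : Fin n) : v i - prevEntry v i = x i - z i + lam * w i := by
    rw [hs i, prevEntry]
    ring
  have hx0 : ∑ i, x i * (x i - z i + lam * w i) = 0 := by
    simp only [← hstat, sum_mul_sub_prevEntry]
    exact sum_eq_zero fun i _ => (drop_mul_eq_zero_iff hn x v).2 ⟨hc, hl⟩ i
  have hy0 : 0 ≤ ∑ i, y i * (x i - z i + lam * w i) := by
    simp only [← hstat, sum_mul_sub_prevEntry]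
    exact sum_nonneg fun i _ => mul_nonneg (drop_nonneg hy i) (hv i)
  have hq : 0 ≤ ∑ i, (y i - x i) ^ 2 := sum_nonneg fun i _ => sq_nonneg _
  have e : ∑ i, (y i - z i) ^ 2 = ∑ i, (x i - z i) ^ 2 + ∑ i, (y i - x i) ^ 2 +
      2 * (∑ i, y i * (x i - z i + lam * w i) - ∑ i, x i * (x i - z i + lam * w i)) -
      2 * lam * (dot w y - dot w x) := by
    simp only [dot, mul_sum, ← sum_add_distrib, ← sum_sub_distrib]
    exact sum_congr rfl fun i _ => by ring
  rw [he, show dot w y = ε from hyw] at e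
  linarith

lemma IsProjOn.exists_isKKT {n : ℕ} (hn : 0 < n) {ε : ℝ} (hε : 0 < ε) {z w x : Fin n → ℝ}
    (hw : w ∈ coneT n) (hw_ne : w ≠ 0) (hz : z ∈ coneT n) (hzw : ε < dot z w)
    (h : IsProjOn (hyperplane w ε ∩ coneT n) z x) : ∃ lam v, IsKKT z w ε x lam v := by
  obtain ⟨hxw, hx⟩ := h.1
  replace hxw : dot w x = ε := hxw
  set p := ∑ i, (x i - z i) * x i with hp
  obtain ⟨lam, hlam⟩ : ∃ lam : ℝ, lam * ε = -p := ⟨-p / ε, div_mul_cancel₀ _ hε.ne'⟩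
  let v : Fin n → ℝ := fun k => ∑ i ∈ Iic k, (x i - z i + lam * w i)
  have hstat (i : Fin n) : v i - prevEntry v i = x i - z i + lam * w i :=
    sum_Iic_sub_prevEntry (fun i => x i - z i + lam * w i) i
  have hv (k : Fin n) : 0 ≤ v k := by
    have hS := sum_Iic_pos hw hw_ne k
    have hmem : (fun i => if i ≤ k then ε / ∑ i ∈ Iic k, w i else 0) ∈
        hyperplane w ε ∩ coneT n := by
      refine ⟨?_, indicator_Iic_mem_coneT k (by positivity)⟩
      simp only [hyperplane, Set.mem_ofPred_eq, dot, sum_mul_indicator_Iic]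
      field_simp
    have hvi := h.sum_mul_sub_nonneg (convex_hyperplane_inter_coneT w ε) hmem
    have e' : ∑ i, (x i - z i) * ((if i ≤ k then ε / ∑ i ∈ Iic k, w i else 0) - x i) =
        (∑ i ∈ Iic k, (x i - z i)) * (ε / ∑ i ∈ Iic k, w i) - p := by
      rw [← sum_mul_indicator_Iic, hp, ← sum_sub_distrib]
      exact sum_congr rfl fun i _ => by ring
    have e : v k = (∑ i ∈ Iic k, (x i - z i)) + lam * ∑ i ∈ Iic k, w i := by
      simp only [v, sum_add_distrib, mul_sum]
    have hprod : v k * (ε / ∑ i ∈ Iic k, w i) =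
        (∑ i ∈ Iic k, (x i - z i)) * (ε / ∑ i ∈ Iic k, w i) - p := by
      rw [e, sub_eq_add_neg, ← hlam]
      field_simp
    rw [e', ← hprod] at hvi
    exact nonneg_of_mul_nonneg_left hvi (by positivity)
  have hx0 : ∑ i, x i * (x i - z i + lam * w i) = 0 := by
    have e : ∑ i, x i * (x i - z i + lam * w i) = p + lam * dot w x := by
      simp only [hp, dot, mul_sum, ← sum_add_distrib]
      exact sum_congr rfl fun i _ => by ring
    rw [e, hxw, hlam, add_neg_cancel]
  have hcomp : ∀ i, drop x i * v i = 0 := by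
    simp only [← hstat, sum_mul_sub_prevEntry] at hx0
    exact fun i => (sum_eq_zero_iff_of_nonneg
      fun i _ => mul_nonneg (drop_nonneg hx i) (hv i)).1 hx0 i (mem_univ i)
  obtain ⟨hc, hl⟩ := (drop_mul_eq_zero_iff hn x v).1 hcomp
  refine ⟨lam, v, ?_, hv, hx, hc, hl, fun i => ?_, hxw⟩
  · have hz0 : 0 ≤ ∑ i, z i * (x i - z i + lam * w i) := by
      simp only [← hstat, sum_mul_sub_prevEntry]
      exact sum_nonneg fun i _ => mul_nonneg (drop_nonneg hz i) (hv i)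
    have e : lam * (dot z w - dot w x) = ∑ i, (x i - z i) ^ 2 +
        (∑ i, z i * (x i - z i + lam * w i) - ∑ i, x i * (x i - z i + lam * w i)) := by
      simp only [dot, mul_sum, ← sum_add_distrib, ← sum_sub_distrib]
      exact sum_congr rfl fun i _ => by ring
    have hpos : 0 < ∑ i, (x i - z i) ^ 2 := by
      refine (sum_nonneg fun i _ => sq_nonneg _).lt_of_ne' fun h0 => hzw.ne ?_
      rw [sum_eq_zero_iff_of_nonneg fun i _ => sq_nonneg _] at h0
      rw [← hxw, dot, dot]
      refine sum_congr rfl fun i hi => ?_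
      rw [sub_eq_zero.1 (pow_eq_zero_iff two_ne_zero |>.1 (h0 i hi)), mul_comm]
    rw [hx0, hxw] at e
    exact pos_of_mul_pos_left (by linarith) (sub_nonneg.2 hzw.le)
  · have := hstat i
    rw [prevEntry] at this
    linarith

/-- KKT conditions. `x⁰` is the projection of `z` onto `H(w,ε) ∩ T`
iff there is a KKT pair `(λ*, v*)` for `x⁰`. -/
theorem proj_iff_kkt {n : ℕ} (hn : 1 ≤ n) (ε : ℝ) (hε : 0 < ε)
    (w : Fin n → ℝ) (hw_anti : Antitone w) (hw_nonneg : ∀ i, 0 ≤ w i) (hw_ne : w ≠ 0)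
    (z : Fin n → ℝ) (hz : z ∈ coneT n) (hw : w ∈ coneT n) (hzw : ε < dot z w)
    (x0 : Fin n → ℝ) :
    IsProjOn (hyperplane w ε ∩ coneT n) z x0 ↔ ∃ lam v, IsKKT z w ε x0 lam v := by
  exact ⟨fun h => h.exists_isKKT hn hε hw hw_ne hz hzw, fun ⟨_, _, h⟩ => h.isProjOn hn⟩
end

section
/- Let κ > 0 and let Δ(κ, n) = {x ∈ ℝⁿ : x ≥ 0 and Σᵢ xᵢ = κ} denote the simplex. Let z, w ∈ T with w ≠ 0, suppose w₁ = w₂ = ⋯ = wₙ, and suppose ⟨z, w⟩ > ε. Then the unique minimizer x* of ½‖x − z‖² subject to ⟨w, x⟩ = ε and x ∈ T equals P_{Δ(ε/w₁, n)}(z); in other words, in this constant-weight case the constraint x ∈ T may be replaced by x ≥ 0. Furthermore, x* = max{z − λ, 0} componentwise, where K = max{k ∈ {1, …, n} : (Σ_{i=1}^{k} zᵢ − ε/w₁)/k < z_k} and λ = (Σ_{i=1}^{K} zᵢ − ε/w₁)/K. -/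
open Finset

/-- A projection of `z` onto a subset of the simplex that contains the soft-thresholded vector
`max (z - lam) 0` must be that vector. -/
lemma IsProjOn.eq_softThreshold {n : ℕ} {κ lam : ℝ} {C : Set (Fin n → ℝ)} {z x : Fin n → ℝ}
    (hC : C ⊆ simplexSet κ n) (hq : (fun i => max (z i - lam) 0) ∈ C) (hx : IsProjOn C z x) :
    x = fun i => max (z i - lam) 0 := by
  set q : Fin n → ℝ := fun i => max (z i - lam) 0 with hq_def
  have hmin := hx.2 q hq
  obtain ⟨hx_nonneg, hx_sum⟩ := hC hx.1
  obtain ⟨-, hq_sum⟩ := hC hq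
  have hpt : ∀ i, (q i - z i) ^ 2 + (x i - q i) ^ 2 - 2 * lam * (x i - q i) ≤
      (x i - z i) ^ 2 := by
    intro i
    have hxi := hx_nonneg i
    rcases le_total (z i - lam) 0 with h | h
    · have hqi : q i = 0 := max_eq_right h
      rw [hqi]
      nlinarith [mul_nonneg (sub_nonneg.2 h) hxi]
    · have hqi : q i = z i - lam := max_eq_left h
      rw [hqi]
      nlinarith
  have hsum := Finset.sum_le_sum fun i (_ : i ∈ Finset.univ) => hpt i
  rw [Finset.sum_sub_distrib, Finset.sum_add_distrib, ← Finset.mul_sum,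
    Finset.sum_sub_distrib, hx_sum, hq_sum] at hsum
  have hzero : ∑ i, (x i - q i) ^ 2 = 0 :=
    le_antisymm (by linarith) (Finset.sum_nonneg fun i _ => sq_nonneg _)
  funext i
  have hi := (Finset.sum_eq_zero_iff_of_nonneg fun i _ => sq_nonneg (x i - q i)).1 hzero i
    (Finset.mem_univ i)
  exact sub_eq_zero.1 (pow_eq_zero_iff two_ne_zero |>.1 hi)

/-- The hyperplane of a constant nonzero weight meets the cone `T` exactly in the antitone
vectors of a simplex. -/
lemma mem_hyperplane_inter_coneT_iff {n : ℕ} {ε c : ℝ} (hc : c ≠ 0) {w x : Fin n → ℝ}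
    (hw : ∀ i, w i = c) :
    x ∈ hyperplane w ε ∩ coneT n ↔ x ∈ simplexSet (ε / c) n ∧ Antitone x := by
  have hdot : dot w x = c * ∑ i, x i := by
    simp only [dot, hw, Finset.mul_sum]
  simp only [hyperplane, coneT, simplexSet, Set.mem_inter_iff, Set.mem_ofPred_eq, hdot,
    eq_div_iff hc, mul_comm c]
  tauto

/-- If `K` is the last index whose entry exceeds its threshold, all later entries are at most
the threshold of `K`. -/
lemma le_threshold_of_lt {n : ℕ} {κ : ℝ} {z : Fin n → ℝ} (hz : Antitone z) {K : Fin n}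
    (hK : ∀ K' : Fin n, ((∑ i : Fin n, if (i : ℕ) ≤ (K' : ℕ) then z i else 0) - κ) /
      ((K' : ℕ) + 1) < z K' → K' ≤ K) {i : Fin n} (hi : K < i) :
    z i ≤ ((∑ j : Fin n, if (j : ℕ) ≤ (K : ℕ) then z j else 0) - κ) / ((K : ℕ) + 1) := by
  have hlt : (K : ℕ) + 1 < n := lt_of_le_of_lt (Nat.succ_le_of_lt hi) i.isLt
  set L : Fin n := ⟨K + 1, hlt⟩ with hL
  have hLi : z i ≤ z L := hz (Fin.le_def.2 (Nat.succ_le_of_lt hi))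
  have hsplit : (∑ j : Fin n, if (j : ℕ) ≤ (L : ℕ) then z j else 0) =
      (∑ j : Fin n, if (j : ℕ) ≤ (K : ℕ) then z j else 0) + z L := by
    rw [← Finset.sum_ite_eq' Finset.univ L z |>.trans (if_pos (Finset.mem_univ L)),
      ← Finset.sum_add_distrib]
    refine Finset.sum_congr rfl fun j _ => ?_
    have hjL : j = L ↔ (j : ℕ) = K + 1 := Fin.ext_iff
    have hLval : (L : ℕ) = K + 1 := rfl
    simp only [hjL, hLval]
    split_ifs <;> first | omega | simp
  have hnot := mt (hK L) (not_le.2 (Fin.lt_def.2 (Nat.lt_succ_self _)))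
  have hLcast : ((L : ℕ) : ℝ) = (K : ℕ) + 1 := by simp [hL]
  have hpos : (0 : ℝ) < (K : ℕ) + 1 := by positivity
  rw [not_lt, hsplit, hLcast, le_div_iff₀ (by positivity)] at hnot
  rw [le_div_iff₀ hpos]
  nlinarith [mul_le_mul_of_nonneg_right hLi hpos.le]

/-- Soft-thresholding at the threshold of the critical index lands in the simplex. -/
lemma softThreshold_mem_simplexSet {n : ℕ} {κ lam : ℝ} {z : Fin n → ℝ} {K : Fin n}
    (hlam : lam = ((∑ j : Fin n, if (j : ℕ) ≤ (K : ℕ) then z j else 0) - κ) / ((K : ℕ) + 1))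
    (hle : ∀ i, i ≤ K → lam ≤ z i) (hgt : ∀ i, K < i → z i ≤ lam) :
    (fun i => max (z i - lam) 0) ∈ simplexSet κ n := by
  refine ⟨fun i => le_max_right _ _, ?_⟩
  have hterm : ∀ i, max (z i - lam) 0 =
      (if (i : ℕ) ≤ (K : ℕ) then z i else 0) - if i ≤ K then lam else 0 := by
    intro i
    simp only [← Fin.le_def]
    split_ifs with h
    · exact max_eq_left (sub_nonneg.2 (hle i h))
    · rw [sub_zero]
      exact max_eq_right (sub_nonpos.2 (hgt i (not_le.1 h)))
  have hcount : (∑ i : Fin n, if i ≤ K then lam else 0) = ((K : ℕ) + 1) * lam := by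
    rw [← Finset.sum_filter, Finset.filter_ge_eq_Iic, Finset.sum_const, Fin.card_Iic,
      nsmul_eq_mul]
    push_cast
    ring
  rw [Finset.sum_congr rfl fun i _ => hterm i, Finset.sum_sub_distrib, hcount, hlam,
    mul_div_cancel₀ _ (by positivity)]
  ring

/-- Projection onto the simplex. For constant weights, the projection
onto `H(w,ε) ∩ T` equals the projection onto the simplex `Δ(ε/w₁, n)`, and is given by
`x* = max{z − λ, 0}` with the stated `K` and `λ`. Here `K : Fin n` encodes the 1-based
index `k = K + 1`, so that `Σ_{i=1}^{k} zᵢ = Σ_{i ≤ K} z i` and `z_k = z K`. -/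
theorem proj_simplex_constant_weights {n : ℕ} (hn : 0 < n) (ε : ℝ) (hε : 0 < ε)
    (w : Fin n → ℝ) (hw_anti : Antitone w) (hw_nonneg : ∀ i, 0 ≤ w i) (hw_ne : w ≠ 0)
    (z : Fin n → ℝ) (hz : z ∈ coneT n) (hw : w ∈ coneT n)
    (hwconst : ∀ i j, w i = w j) (hzw : ε < dot z w)
    (xs : Fin n → ℝ) (hxs : IsProjOn (hyperplane w ε ∩ coneT n) z xs)
    (p : Fin n → ℝ) (hp : IsProjOn (simplexSet (ε / w ⟨0, hn⟩) n) z p) :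
    xs = p ∧
    ∃ K : Fin n,
      ((∑ i : Fin n, if (i : ℕ) ≤ (K : ℕ) then z i else 0) - ε / w ⟨0, hn⟩) /
          ((K : ℕ) + 1) < z K ∧
      (∀ K' : Fin n,
        ((∑ i : Fin n, if (i : ℕ) ≤ (K' : ℕ) then z i else 0) - ε / w ⟨0, hn⟩) /
            ((K' : ℕ) + 1) < z K' → K' ≤ K) ∧
      ∀ i, xs i =
        max (z i - ((∑ j : Fin n, if (j : ℕ) ≤ (K : ℕ) then z j else 0) - ε / w ⟨0, hn⟩) /
          ((K : ℕ) + 1)) 0 := by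
  set κ := ε / w ⟨0, hn⟩ with hκ_def
  have hc : w ⟨0, hn⟩ ≠ 0 := fun h => hw_ne (funext fun i => (hwconst i _).trans h)
  have hκ : 0 < κ := div_pos hε (lt_of_le_of_ne (hw_nonneg _) hc.symm)
  let good : Finset (Fin n) := Finset.univ.filter fun K : Fin n =>
    ((∑ i : Fin n, if (i : ℕ) ≤ (K : ℕ) then z i else 0) - κ) / ((K : ℕ) + 1) < z K
  have hgood : good.Nonempty := by
    refine ⟨⟨0, hn⟩, Finset.mem_filter.2 ⟨Finset.mem_univ _, ?_⟩⟩
    have hsum : (∑ i : Fin n, if (i : ℕ) ≤ 0 then z i else 0) = z ⟨0, hn⟩ := by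
      rw [Finset.sum_eq_single_of_mem ⟨0, hn⟩ (Finset.mem_univ _)]
      · simp
      · intro i _ hi
        exact if_neg fun h => hi (Fin.ext (Nat.le_zero.1 h))
    simp only [hsum, Nat.cast_zero, zero_add, div_one]
    linarith
  obtain ⟨K, hK_mem, hK_max⟩ := good.exists_max_image id hgood
  have hK := (Finset.mem_filter.1 hK_mem).2
  have hmax : ∀ K' : Fin n, ((∑ i : Fin n, if (i : ℕ) ≤ (K' : ℕ) then z i else 0) - κ) /
      ((K' : ℕ) + 1) < z K' → K' ≤ K := fun K' h =>
    hK_max K' (Finset.mem_filter.2 ⟨Finset.mem_univ _, h⟩)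
  have hmem := softThreshold_mem_simplexSet rfl (fun i hi => hK.le.trans (hz.1 hi))
    (fun i hi => le_threshold_of_lt hz.1 hmax hi)
  have hiff : ∀ x, x ∈ hyperplane w ε ∩ coneT n ↔ x ∈ simplexSet κ n ∧ Antitone x := fun x =>
    mem_hyperplane_inter_coneT_iff hc fun i => hwconst i _
  have hp_eq := hp.eq_softThreshold subset_rfl hmem
  have hxs_eq := hxs.eq_softThreshold (fun x hx => ((hiff x).1 hx).1)
    ((hiff _).2 ⟨hmem, fun i j hij => max_le_max_right 0 (sub_le_sub_right (hz.1 hij) _)⟩)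
  exact ⟨hxs_eq.trans hp_eq.symm, K, hK, hmax, congrFun hxs_eq⟩
end

section
/- Let z, w ∈ T with w ≠ 0 and ⟨z, w⟩ > ε, let x* = P_{H(w,ε) ∩ T}(z), set 𝒢* = 𝒢(x*), and let (λ*, v*) be a KKT pair for x*. Then for every real λ with 0 ≤ λ ≤ λ*: 𝒢(z) ≼ 𝒢(z − λw), 𝒢(z − λw) = 𝒢(z_{𝒢(z − λw)}), and 𝒢(z − λw) ≼ 𝒢*. -/
open Finset

theorem Refines.antisymm {n : ℕ} {P Q : Finset (Finset (Fin n))}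
    (hP : IsIntervalPartition P) (hQ : IsIntervalPartition Q)
    (hPQ : Refines P Q) (hQP : Refines Q P) : P = Q := by
  have key : ∀ {A B : Finset (Finset (Fin n))}, IsIntervalPartition A → Refines A B →
      Refines B A → A ⊆ B := by
    intro A B hA hAB hBA G hG
    obtain ⟨H, hH, hGH⟩ := hAB G hG
    obtain ⟨G', hG', hHG'⟩ := hBA H hH
    obtain ⟨i, hi⟩ := hA.1 G hG
    have hGG' : G = G' := (hA.2.1 i).unique ⟨hG, hi⟩ ⟨hG', hHG' (hGH hi)⟩
    have hHG : H ⊆ G := by rwa [hGG']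
    rwa [hGH.antisymm hHG]
  exact (key hP hPQ hQP).antisymm (key hQ hQP hPQ)

theorem refines_of_sameBlock_succ {n : ℕ} {P Q : Finset (Finset (Fin n))}
    (hP : IsIntervalPartition P) (hQ : IsIntervalPartition Q)
    (h : ∀ (i : Fin n) (hi : i.val + 1 < n),
      SameBlock P i ⟨i.val + 1, hi⟩ → SameBlock Q i ⟨i.val + 1, hi⟩) :
    Refines P Q := by
  intro G hG
  have hne := hP.1 G hG
  set m := G.min' hne
  have hm : m ∈ G := G.min'_mem hne
  obtain ⟨H, ⟨hH, hmH⟩, -⟩ := hQ.2.1 m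
  refine ⟨H, hH, ?_⟩
  have step : ∀ k, m.val ≤ k → ∀ hk : k < n, (⟨k, hk⟩ : Fin n) ∈ G → (⟨k, hk⟩ : Fin n) ∈ H := by
    intro k hmk
    induction k, hmk using Nat.le_induction with
    | base => intro _ _; exact hmH
    | succ k hmk ih =>
      intro hk hkG
      have hk' : k < n := by omega
      have hkG' : (⟨k, hk'⟩ : Fin n) ∈ G :=
        hP.2.2 G hG m hm _ hkG _ hmk (Nat.le_succ k)
      obtain ⟨H', hH', h1, h2⟩ := h ⟨k, hk'⟩ hk ⟨G, hG, hkG', hkG⟩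
      rwa [(hQ.2.1 ⟨k, hk'⟩).unique ⟨hH, ih hk' hkG'⟩ ⟨hH', h1⟩]
  intro j hj
  exact step j.val (G.min'_le j hj) j.isLt hj

theorem IsGroupPartition.refines {n : ℕ} {x y : Fin n → ℝ} {P Q : Finset (Finset (Fin n))}
    (hP : IsGroupPartition x P) (hQ : IsGroupPartition y Q)
    (h : ∀ (i : Fin n) (hi : i.val + 1 < n),
      x i ≤ x ⟨i.val + 1, hi⟩ → y i ≤ y ⟨i.val + 1, hi⟩) :
    Refines P Q :=
  refines_of_sameBlock_succ hP.1 hQ.1 fun i hi hs =>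
    (hQ.2 i hi).2 (h i hi ((hP.2 i hi).1 hs))

theorem IsAvg.eq_of_sameBlock {n : ℕ} {P : Finset (Finset (Fin n))} {z v : Fin n → ℝ}
    (hv : IsAvg P z v) {i j : Fin n} (h : SameBlock P i j) : v i = v j := by
  obtain ⟨G, hG, hi, hj⟩ := h
  rw [hv G hG i hi, hv G hG j hj]

/-- Averaging an antitone vector keeps a strict decrease at a boundary between blocks. -/
theorem IsAvg.lt_of_not_sameBlock {n : ℕ} {P : Finset (Finset (Fin n))} {z v : Fin n → ℝ}
    (hP : IsIntervalPartition P) (hz : Antitone z) (hv : IsAvg P z v)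
    {i : Fin n} (hi : i.val + 1 < n) (hs : ¬ SameBlock P i ⟨i.val + 1, hi⟩)
    (hlt : z ⟨i.val + 1, hi⟩ < z i) : v ⟨i.val + 1, hi⟩ < v i := by
  set j : Fin n := ⟨i.val + 1, hi⟩
  obtain ⟨G, ⟨hG, hiG⟩, -⟩ := hP.2.1 i
  obtain ⟨H, ⟨hH, hjH⟩, -⟩ := hP.2.1 j
  have hij : i ≤ j := Nat.le_succ _
  have hGle : ∀ k ∈ G, k ≤ i := by
    intro k hk
    by_contra hki
    exact hs ⟨G, hG, hiG, hP.2.2 G hG i hiG k hk j hij (not_le.1 hki)⟩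
  have hHle : ∀ k ∈ H, j ≤ k := by
    intro k hk
    by_contra hjk
    exact hs ⟨H, hH, hP.2.2 H hH k hk j hjH i (Nat.lt_succ_iff.1 (not_le.1 hjk)) hij, hjH⟩
  have hGpos : (0 : ℝ) < G.card := by exact_mod_cast Finset.card_pos.2 ⟨i, hiG⟩
  have hHpos : (0 : ℝ) < H.card := by exact_mod_cast Finset.card_pos.2 ⟨j, hjH⟩
  have hvi : z i ≤ v i := by
    rw [hv G hG i hiG, le_div_iff₀ hGpos, mul_comm, ← nsmul_eq_mul]
    exact Finset.card_nsmul_le_sum G z _ fun k hk => hz (hGle k hk)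
  have hvj : v j ≤ z j := by
    rw [hv H hH j hjH, div_le_iff₀ hHpos, mul_comm, ← nsmul_eq_mul]
    exact Finset.sum_le_card_nsmul H z _ fun k hk => hz (hHle k hk)
  linarith

/-- A multiplier vanishes wherever the solution strictly decreases, so the solution is
nondecreasing wherever `z - lam * w` is. -/
theorem IsKKT.le_succ {n : ℕ} {z w x v : Fin n → ℝ} {ε lam : ℝ}
    (h : IsKKT z w ε x lam v) {i : Fin n} (hi : i.val + 1 < n)
    (hle : z i - lam * w i ≤ z ⟨i.val + 1, hi⟩ - lam * w ⟨i.val + 1, hi⟩) :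
    x i ≤ x ⟨i.val + 1, hi⟩ := by
  obtain ⟨-, hv, -, hcomp, -, hstat, -⟩ := h
  by_contra! hlt
  have hvi : v i = 0 :=
    (mul_eq_zero.1 (hcomp i hi)).resolve_right (sub_pos.2 hlt).ne'
  have h1 := hstat i
  have h2 := hstat ⟨i.val + 1, hi⟩
  simp only [Nat.add_sub_cancel, Nat.succ_ne_zero, dite_false, Fin.eta, hvi] at h2
  have h3 := hv ⟨i.val + 1, hi⟩
  split_ifs at h1 with h0
  · linarith
  · linarith [hv ⟨i.val - 1, lt_of_le_of_lt (Nat.sub_le _ _) i.isLt⟩]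

/-- Increasing Partitions, part 1. For `0 ≤ λ ≤ λ*`:
`𝒢(z) ≼ 𝒢(z − λw)`, `𝒢(z − λw) = 𝒢(z_{𝒢(z − λw)})`, and `𝒢(z − λw) ≼ 𝒢*`. -/
theorem increasing_partitions {n : ℕ} (hn : 1 ≤ n) (ε : ℝ) (hε : 0 < ε)
    (w : Fin n → ℝ) (hw_anti : Antitone w) (hw_nonneg : ∀ i, 0 ≤ w i) (hw_ne : w ≠ 0)
    (z : Fin n → ℝ) (hz : z ∈ coneT n) (hw : w ∈ coneT n) (hzw : ε < dot z w)
    (xs : Fin n → ℝ) (hxs : IsProjOn (hyperplane w ε ∩ coneT n) z xs)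
    (Gs : Finset (Finset (Fin n))) (hGs : IsGroupPartition xs Gs)
    (lamstar : ℝ) (vstar : Fin n → ℝ) (hKKT : IsKKT z w ε xs lamstar vstar)
    (lam : ℝ) (hlam_nonneg : 0 ≤ lam) (hlam : lam ≤ lamstar)
    (Gz : Finset (Finset (Fin n))) (hGz : IsGroupPartition z Gz)
    (G1 : Finset (Finset (Fin n))) (hG1 : IsGroupPartition (fun i => z i - lam * w i) G1)
    (za : Fin n → ℝ) (hza : IsAvg G1 z za)
    (G2 : Finset (Finset (Fin n))) (hG2 : IsGroupPartition za G2) :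
    Refines Gz G1 ∧ G1 = G2 ∧ Refines G1 Gs := by
  have hw_succ : ∀ (i : Fin n) (hi : i.val + 1 < n), w ⟨i.val + 1, hi⟩ ≤ w i :=
    fun i hi => hw_anti (Nat.le_succ i.val)
  refine ⟨hGz.refines hG1 fun i hi hle => ?_, Refines.antisymm hG1.1 hG2.1 ?_ ?_,
    hG1.refines hGs fun i hi hle => hKKT.le_succ hi ?_⟩
  · linarith [mul_le_mul_of_nonneg_left (hw_succ i hi) hlam_nonneg]
  · exact refines_of_sameBlock_succ hG1.1 hG2.1 fun i hi hs =>
      (hG2.2 i hi).2 (hza.eq_of_sameBlock hs).le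
  · refine refines_of_sameBlock_succ hG2.1 hG1.1 fun i hi hs => ?_
    by_contra hns
    have hlt : z ⟨i.val + 1, hi⟩ < z i := by
      have := not_le.1 (mt (hG1.2 i hi).2 hns)
      linarith [mul_le_mul_of_nonneg_left (hw_succ i hi) hlam_nonneg]
    exact (hza.lt_of_not_sameBlock hG1.1 hz.1 hi hns hlt).not_ge ((hG2.2 i hi).1 hs)
  · have := mul_nonneg (sub_nonneg.2 hlam) (sub_nonneg.2 (hw_succ i hi))
    linarith
end

section
/- Let z, w ∈ T with w ≠ 0 and ⟨z, w⟩ > ε, let x* = P_{H(w,ε) ∩ T}(z), and set 𝒢* = 𝒢(x*). Then for every partition 𝒢 ∈ 𝒫ₙ with 𝒢 ≼ 𝒢*, one has x* = P_{H(w_𝒢, ε) ∩ T}(z_𝒢). -/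
open Finset

/-- A sum over all indices splits as a sum over the blocks of an interval partition. -/
lemma IsIntervalPartition.sum_blocks {n : ℕ} {G : Finset (Finset (Fin n))}
    (hG : IsIntervalPartition G) (f : Fin n → ℝ) : ∑ i, f i = ∑ H ∈ G, ∑ i ∈ H, f i := by
  have hdisj : (G : Set (Finset (Fin n))).PairwiseDisjoint id := by
    intro A hA B hB hAB
    refine Finset.disjoint_left.2 fun i hiA hiB => hAB ?_
    exact (hG.2.1 i).unique ⟨hA, hiA⟩ ⟨hB, hiB⟩
  have huniv : (Finset.univ : Finset (Fin n)) = G.biUnion id := by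
    ext i
    obtain ⟨A, hA, -⟩ := hG.2.1 i
    simpa using ⟨A, hA⟩
  rw [huniv, Finset.sum_biUnion hdisj]
  rfl

/-- `c` is constant on every block of `P`. -/
def ConstOnBlocks {n : ℕ} (P : Finset (Finset (Fin n))) (c : Fin n → ℝ) : Prop :=
  ∀ H ∈ P, ∀ i ∈ H, ∀ j ∈ H, c i = c j

lemma ConstOnBlocks.sub {n : ℕ} {P : Finset (Finset (Fin n))} {c d : Fin n → ℝ}
    (hc : ConstOnBlocks P c) (hd : ConstOnBlocks P d) :
    ConstOnBlocks P fun i => c i - d i := by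
  intro H hH i hi j hj
  simp only [hc H hH i hi j hj, hd H hH i hi j hj]

lemma ConstOnBlocks.of_refines {n : ℕ} {P Q : Finset (Finset (Fin n))} {c : Fin n → ℝ}
    (hc : ConstOnBlocks Q c) (hPQ : Refines P Q) : ConstOnBlocks P c := by
  intro H hH i hi j hj
  obtain ⟨K, hK, hHK⟩ := hPQ H hH
  exact hc K hK i (hHK hi) j (hHK hj)

lemma IsAvg.constOnBlocks {n : ℕ} {P : Finset (Finset (Fin n))} {y v : Fin n → ℝ}
    (hv : IsAvg P y v) : ConstOnBlocks P v := fun H hH i hi j hj => by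
  rw [hv H hH i hi, hv H hH j hj]

/-- Averaging preserves inner products with blockwise constant vectors. -/
lemma IsAvg.sum_mul {n : ℕ} {G : Finset (Finset (Fin n))} (hG : IsIntervalPartition G)
    {y v c : Fin n → ℝ} (hv : IsAvg G y v) (hc : ConstOnBlocks G c) :
    ∑ i, c i * v i = ∑ i, c i * y i := by
  rw [hG.sum_blocks, hG.sum_blocks]
  refine Finset.sum_congr rfl fun H hH => ?_
  obtain ⟨a, ha⟩ := hG.1 H hH
  have hcard : (H.card : ℝ) ≠ 0 := by
    exact_mod_cast (Finset.card_pos.2 ⟨a, ha⟩).ne'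
  calc ∑ i ∈ H, c i * v i = ∑ i ∈ H, c a * ((∑ k ∈ H, y k) / (H.card : ℝ)) :=
        Finset.sum_congr rfl fun i hi => by rw [hc H hH i hi a ha, hv H hH i hi]
    _ = c a * ∑ k ∈ H, y k := by
        rw [Finset.sum_const, nsmul_eq_mul]
        field_simp
    _ = ∑ i ∈ H, c i * y i := by
        rw [Finset.mul_sum]
        exact Finset.sum_congr rfl fun i hi => by rw [hc H hH i hi a ha]

lemma IsIntervalPartition.exists_isAvg {n : ℕ} {G : Finset (Finset (Fin n))}
    (hG : IsIntervalPartition G) (y : Fin n → ℝ) : ∃ v, IsAvg G y v := by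
  choose B hB using fun i => (hG.2.1 i).exists
  refine ⟨fun i => (∑ k ∈ B i, y k) / ((B i).card : ℝ), fun H hH i hi => ?_⟩
  rw [(hG.2.1 i).unique ⟨hH, hi⟩ (hB i)]

/-- Averaging over an interval partition preserves the monotone nonnegative cone. -/
lemma IsAvg.mem_coneT {n : ℕ} {G : Finset (Finset (Fin n))} (hG : IsIntervalPartition G)
    {y v : Fin n → ℝ} (hv : IsAvg G y v) (hy : y ∈ coneT n) : v ∈ coneT n := by
  refine ⟨fun i j hij => ?_, fun i => ?_⟩
  · obtain ⟨A, ⟨hA, hiA⟩, -⟩ := hG.2.1 i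
    obtain ⟨B, ⟨hB, hjB⟩, -⟩ := hG.2.1 j
    by_cases hAB : A = B
    · subst hAB
      exact (hv.constOnBlocks A hA j hjB i hiA).le
    have hle : ∀ a ∈ A, ∀ b ∈ B, a ≤ b := by
      intro a ha b hb
      by_contra! hba
      rcases le_total b i with hbi | hib
      · exact hAB ((hG.2.1 i).unique ⟨hA, hiA⟩ ⟨hB, hG.2.2 B hB b hb j hjB i hbi hij⟩)
      · exact hAB ((hG.2.1 b).unique ⟨hA, hG.2.2 A hA i hiA a ha b hib hba.le⟩ ⟨hB, hb⟩)
    have hcA : (0 : ℝ) < A.card := by exact_mod_cast Finset.card_pos.2 ⟨i, hiA⟩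
    have hcB : (0 : ℝ) < B.card := by exact_mod_cast Finset.card_pos.2 ⟨j, hjB⟩
    have hvj : ∀ a ∈ A, v j ≤ y a := by
      intro a ha
      rw [hv B hB j hjB, div_le_iff₀ hcB, mul_comm, ← nsmul_eq_mul]
      exact Finset.sum_le_card_nsmul _ _ _ fun b hb => hy.1 (hle a ha b hb)
    rw [hv A hA i hiA, le_div_iff₀ hcA, mul_comm, ← nsmul_eq_mul]
    exact Finset.card_nsmul_le_sum _ _ _ hvj
  · obtain ⟨A, ⟨hA, hiA⟩, -⟩ := hG.2.1 i
    rw [hv A hA i hiA]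
    exact div_nonneg (Finset.sum_nonneg fun k _ => hy.2 k) (Nat.cast_nonneg _)

/-- An antitone vector is constant on the blocks of its group partition. -/
lemma IsGroupPartition.constOnBlocks {n : ℕ} {x : Fin n → ℝ} {P : Finset (Finset (Fin n))}
    (hP : IsGroupPartition x P) (hx : Antitone x) : ConstOnBlocks P x := by
  have key : ∀ H ∈ P, ∀ i ∈ H, ∀ m : ℕ, i.val ≤ m → ∀ hm : m < n,
      (⟨m, hm⟩ : Fin n) ∈ H → x i ≤ x ⟨m, hm⟩ := by
    intro H hH i hi m him
    induction m, him using Nat.le_induction with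
    | base => exact fun _ _ => le_rfl
    | succ m him ih =>
      intro hm hmH
      have hmem : (⟨m, by omega⟩ : Fin n) ∈ H :=
        hP.1.2.2 H hH i hi _ hmH _ him (Fin.mk_le_mk.2 m.le_succ)
      exact (ih _ hmem).trans ((hP.2 ⟨m, by omega⟩ hm).1 ⟨H, hH, hmem, hmH⟩)
  intro H hH i hi j hj
  rcases le_total i j with hij | hij
  · exact le_antisymm (key H hH i hi j hij j.isLt hj) (hx hij)
  · exact le_antisymm (hx hij) (key H hH j hj i hij i.isLt hi)

/-- Increasing Partitions, part 2. If `𝒢 ≼ 𝒢*`, then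
`x* = P_{H(w_𝒢, ε) ∩ T}(z_𝒢)`. -/
theorem proj_avg_of_refines {n : ℕ} (hn : 1 ≤ n) (ε : ℝ) (hε : 0 < ε)
    (w : Fin n → ℝ) (hw_anti : Antitone w) (hw_nonneg : ∀ i, 0 ≤ w i) (hw_ne : w ≠ 0)
    (z : Fin n → ℝ) (hz : z ∈ coneT n) (hw : w ∈ coneT n) (hzw : ε < dot z w)
    (xs : Fin n → ℝ) (hxs : IsProjOn (hyperplane w ε ∩ coneT n) z xs)
    (Gs : Finset (Finset (Fin n))) (hGs : IsGroupPartition xs Gs)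
    (G : Finset (Finset (Fin n))) (hG : IsIntervalPartition G) (hGGs : Refines G Gs)
    (za wa : Fin n → ℝ) (hza : IsAvg G z za) (hwa : IsAvg G w wa) :
    IsProjOn (hyperplane wa ε ∩ coneT n) za xs := by
  have hxG : ConstOnBlocks G xs := (hGs.constOnBlocks hxs.1.2.1).of_refines hGGs
  have hdot : ∀ {c y v : Fin n → ℝ}, ConstOnBlocks G c → IsAvg G y v →
      ∑ i, c i * v i = ∑ i, c i * y i := fun hc hv => hv.sum_mul hG hc
  refine ⟨⟨?_, hxs.1.2⟩, fun y hy => ?_⟩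
  · have hwx : ∑ i, w i * xs i = ε := hxs.1.1
    change ∑ i, wa i * xs i = ε
    rw [← hwx]
    simpa only [mul_comm] using hdot hxG hwa
  obtain ⟨v, hv⟩ := hG.exists_isAvg y
  have hvH : v ∈ hyperplane w ε := by
    have hwy : ∑ i, wa i * y i = ε := hy.1
    change ∑ i, w i * v i = ε
    rw [← hwy, ← hdot hwa.constOnBlocks hv]
    simpa only [mul_comm] using (hdot hv.constOnBlocks hwa).symm
  have hmin := hxs.2 v ⟨hvH, hv.mem_coneT hG hy.2⟩
  have hcross_y := hdot (hv.constOnBlocks.sub hza.constOnBlocks) hv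
  have hcross_z := hdot (hv.constOnBlocks.sub hxG) hza
  have hsq : 0 ≤ ∑ i, (y i - v i) ^ 2 := Finset.sum_nonneg fun i _ => sq_nonneg _
  have hsplit : ∑ i, (y i - za i) ^ 2 - ∑ i, (xs i - za i) ^ 2 =
      ∑ i, (y i - v i) ^ 2 + (∑ i, (v i - z i) ^ 2 - ∑ i, (xs i - z i) ^ 2) +
      2 * (∑ i, (v i - za i) * y i - ∑ i, (v i - za i) * v i) +
      2 * (∑ i, (v i - xs i) * z i - ∑ i, (v i - xs i) * za i) := by
    simp only [← Finset.sum_sub_distrib, Finset.mul_sum, ← Finset.sum_add_distrib]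
    exact Finset.sum_congr rfl fun i _ => by ring
  linarith
end

section
/- Let z, w ∈ T with w ≠ 0 and ⟨z, w⟩ > ε, let x* = P_{H(w,ε) ∩ T}(z), and let (λ*, v*) be a KKT pair for x*. Then λ* ≥ λ₁, where λ₁ = (⟨z, w⟩ − ε)/‖w‖². -/
open Finset

/-- Summation by parts: for antitone `w` and nonnegative `V` with `V 0 = 0`, the sum of
`wᵢ (Vᵢ₊₁ - Vᵢ)` is at least its last boundary term. -/
lemma mul_le_sum_mul_sub (m : ℕ) (w : Fin (m + 1) → ℝ) (hw : Antitone w) (V : ℕ → ℝ)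
    (hV0 : V 0 = 0) (hV : ∀ k, 0 ≤ V k) :
    w (Fin.last m) * V (m + 1) ≤ ∑ i : Fin (m + 1), w i * (V (i + 1) - V i) := by
  induction m with
  | zero => simp [hV0]
  | succ m ih =>
    rw [Fin.sum_univ_castSucc]
    have h := ih (fun i => w i.castSucc) fun a b hab => hw (Fin.castSucc_le_castSucc_iff.mpr hab)
    have hle : w (Fin.last (m + 1)) ≤ w (Fin.last m).castSucc := hw (Fin.le_last _)
    have hmul := mul_le_mul_of_nonneg_right hle (hV (m + 1))
    simp only [Fin.val_castSucc, Fin.val_last] at h ⊢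
    linarith

/-- Any KKT multiplier `λ*` for `x* = P_{H(w,ε) ∩ T}(z)` satisfies
`λ* ≥ λ₁ = (⟨z,w⟩ − ε)/‖w‖²`. -/
theorem lamstar_ge_lam1 {n : ℕ} (hn : 1 ≤ n) (ε : ℝ) (hε : 0 < ε)
    (w : Fin n → ℝ) (hw_anti : Antitone w) (hw_nonneg : ∀ i, 0 ≤ w i) (hw_ne : w ≠ 0)
    (z : Fin n → ℝ) (hz : z ∈ coneT n) (hw : w ∈ coneT n) (hzw : ε < dot z w)
    (xs : Fin n → ℝ) (hxs : IsProjOn (hyperplane w ε ∩ coneT n) z xs)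
    (lamstar : ℝ) (vstar : Fin n → ℝ) (hKKT : IsKKT z w ε xs lamstar vstar) :
    lam1 z w ε ≤ lamstar := by
  obtain ⟨-, hv, -, -, -, hx, hdot⟩ := hKKT
  obtain ⟨m, rfl⟩ : ∃ m, n = m + 1 := ⟨n - 1, by omega⟩
  have hww : 0 < dot w w := by
    obtain ⟨i, hi⟩ := Function.ne_iff.mp hw_ne
    exact Finset.sum_pos' (fun j _ => mul_self_nonneg (w j))
      ⟨i, Finset.mem_univ i, mul_self_pos.mpr hi⟩
  let V : ℕ → ℝ := fun k =>
    if k = 0 then 0 else if h : k - 1 < m + 1 then vstar ⟨k - 1, h⟩ else 0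
  have hV : ∀ k, 0 ≤ V k := by
    intro k
    dsimp only [V]
    split_ifs
    exacts [le_rfl, hv _, le_rfl]
  have hparts := mul_le_sum_mul_sub m w hw_anti V (by simp [V]) hV
  have hnonneg := (mul_nonneg (hw_nonneg (Fin.last m)) (hV (m + 1))).trans hparts
  have hsplit : dot w xs = dot z w - lamstar * dot w w +
      ∑ i : Fin (m + 1), w i * (V (i + 1) - V i) := by
    simp only [dot, Finset.mul_sum]
    rw [← Finset.sum_sub_distrib, ← Finset.sum_add_distrib]
    refine Finset.sum_congr rfl fun i _ => ?_
    have hsucc : V (i + 1) = vstar i := by simp [V, i.isLt, -Order.lt_add_one_iff]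
    have hpred : V i = if _ : i.val = 0 then 0 else
        vstar ⟨i.val - 1, lt_of_le_of_lt (Nat.sub_le _ _) i.isLt⟩ := by
      dsimp only [V]
      split_ifs with h0 h1
      · rfl
      · rfl
      · omega
    rw [hx i, ← hpred, hsucc]
    ring
  rw [lam1, div_le_iff₀ hww]
  linarith
end

section
/- Assume z, w ∈ T, w ≠ 0, ⟨w, z⟩ > ε, and w = w_{𝒢(z)}. If λ₁ ≤ r < ∞ and zₙ − λ₁wₙ ≥ 0, then x* = z − λ₁w, where x* = P_{H(w,ε) ∩ T}(z). -/
open Finset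

/-- If `lam ≤ rmin z w`, then `z - lam • w` is still antitone. -/
theorem antitone_sub_mul_of_le_rmin {n : ℕ} {z w : Fin n → ℝ} {lam : ℝ}
    (hz : Antitone z) (hw : Antitone w) (hlam : (lam : EReal) ≤ rmin z w) :
    Antitone fun i => z i - lam * w i := by
  cases n with
  | zero => exact fun i => i.elim0
  | succ m =>
    refine Fin.antitone_iff_succ_le.2 fun i => ?_
    have hi : i.castSucc.val + 1 < m + 1 := by simp
    have hle := hlam.trans (iInf_le _ i.castSucc)
    rw [dif_pos hi] at hle
    change (lam : EReal) ≤ if w i.castSucc - w i.succ = 0 then (⊤ : EReal) else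
      (((z i.castSucc - z i.succ) / (w i.castSucc - w i.succ) : ℝ) : EReal) at hle
    have hzi := hz i.castSucc_le_succ
    have hwi := hw i.castSucc_le_succ
    split_ifs at hle with h0
    · have : w i.castSucc = w i.succ := sub_eq_zero.1 h0
      simp only [this]
      linarith
    · have hpos : 0 < w i.castSucc - w i.succ :=
        lt_of_le_of_ne (sub_nonneg.2 hwi) (Ne.symm h0)
      have := (le_div_iff₀ hpos).1 (EReal.coe_le_coe_iff.1 hle)
      linarith

/-- The point `z - lam1 z w ε • w` lies on the hyperplane `⟨w, x⟩ = ε`. -/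
theorem sub_lam1_mul_mem_hyperplane {n : ℕ} {w : Fin n → ℝ} (hw : w ≠ 0)
    (z : Fin n → ℝ) (ε : ℝ) :
    (fun i => z i - lam1 z w ε * w i) ∈ hyperplane w ε := by
  have hww : dot w w ≠ 0 := fun h => hw <| funext fun i =>
    mul_self_eq_zero.1 <|
      (sum_eq_zero_iff_of_nonneg fun j _ => mul_self_nonneg (w j)).1 h i (mem_univ i)
  have hexp : dot w (fun i => z i - lam1 z w ε * w i) =
      dot z w - lam1 z w ε * dot w w := by
    simp only [dot, mul_sum, ← sum_sub_distrib]
    exact sum_congr rfl fun i _ => by ring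
  change dot w (fun i => z i - lam1 z w ε * w i) = ε
  rw [hexp, lam1, div_mul_cancel₀ _ hww]
  ring

/-- A point of `C ⊆ H(w, ε)` of the form `z - lam • w` is the only projection of `z` onto `C`. -/
theorem IsProjOn.eq_sub_mul {n : ℕ} {C : Set (Fin n → ℝ)} {w z x : Fin n → ℝ} {ε lam : ℝ}
    (hx : IsProjOn C z x) (hC : C ⊆ hyperplane w ε) (hy : (fun i => z i - lam * w i) ∈ C) :
    x = fun i => z i - lam * w i := by
  have hle := hx.2 _ hy
  have hxw : dot w x = ε := hC hx.1
  have hyw : dot w (fun i => z i - lam * w i) = ε := hC hy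
  have hpyth : ∑ i, (x i - z i) ^ 2 = ∑ i, (x i - (z i - lam * w i)) ^ 2 +
      ∑ i, (z i - lam * w i - z i) ^ 2 -
      2 * lam * (dot w x - dot w (fun i => z i - lam * w i)) := by
    simp only [dot, mul_sum, ← sum_sub_distrib, ← sum_add_distrib]
    exact sum_congr rfl fun i _ => by ring
  rw [hxw, hyw] at hpyth
  have hnonneg : ∀ i ∈ univ, 0 ≤ (x i - (z i - lam * w i)) ^ 2 := fun i _ => sq_nonneg _
  have hzero : ∑ i, (x i - (z i - lam * w i)) ^ 2 = 0 :=
    le_antisymm (by linarith) (sum_nonneg hnonneg)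
  exact funext fun i => sub_eq_zero.1 <| pow_eq_zero_iff two_ne_zero |>.1 <|
    (sum_eq_zero_iff_of_nonneg hnonneg).1 hzero i (mem_univ i)

/-- Alternative 3. If `λ₁ ≤ r < ∞` and `zₙ − λ₁wₙ ≥ 0`, then
`x* = z − λ₁ w`. -/
theorem alternative_three {n : ℕ} (hn : 0 < n) (ε : ℝ) (hε : 0 < ε)
    (w : Fin n → ℝ) (hw_anti : Antitone w) (hw_nonneg : ∀ i, 0 ≤ w i) (hw_ne : w ≠ 0)
    (z : Fin n → ℝ) (hz : z ∈ coneT n) (hw : w ∈ coneT n) (hzw : ε < dot w z)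
    (Gz : Finset (Finset (Fin n))) (hGz : IsGroupPartition z Gz) (hwG : IsAvg Gz w w)
    (hr1 : (lam1 z w ε : EReal) ≤ rmin z w) (hr2 : rmin z w < ⊤)
    (hzn : 0 ≤ z (lastIdx hn) - lam1 z w ε * w (lastIdx hn))
    (xs : Fin n → ℝ) (hxs : IsProjOn (hyperplane w ε ∩ coneT n) z xs) :
    xs = fun i => z i - lam1 z w ε * w i := by
  have hanti := antitone_sub_mul_of_le_rmin hz.1 hw_anti hr1
  refine hxs.eq_sub_mul Set.inter_subset_left
    ⟨sub_lam1_mul_mem_hyperplane hw_ne z ε, hanti, fun i => hzn.trans (hanti ?_)⟩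
  exact Fin.le_def.2 (Nat.le_sub_one_of_lt i.isLt)
end

section
/- Assume z, w ∈ T, w ≠ 0, ⟨w, z⟩ > ε, and w = w_{𝒢(z)}. Let x* = P_{H(w,ε) ∩ T}(z) and let (λ*, v*) be a KKT pair for x*. If λ₁ ≤ r < ∞ and zₙ − λ₁wₙ < 0, then x*ₙ = 0 and λ* ≥ λ₀; in particular, if additionally λ₀ > r, then λ* ≥ λ₀ > r. -/
open Finset

/-- Abel summation inequality: a nonincreasing nonnegative sequence weighs the increments of a
nonnegative sequence starting at `0` to at least the last weighted term. -/
lemma mul_le_sum_mul_sub_of_antitone {u v : ℕ → ℝ} (hu : Antitone u) (hv : ∀ i, 0 ≤ v i)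
    (hv0 : v 0 = 0) (k : ℕ) :
    u k * v k ≤ ∑ i ∈ Finset.range k, u i * (v (i + 1) - v i) := by
  induction k with
  | zero => simp [hv0]
  | succ k ih =>
    rw [Finset.sum_range_succ]
    have := mul_le_mul_of_nonneg_right (hu k.le_succ) (hv (k + 1))
    simp only [Nat.succ_eq_add_one] at this
    linarith

lemma sum_mul_sub_pred_nonneg {n : ℕ} {u v : Fin n → ℝ} (hu : Antitone u)
    (hu0 : ∀ i, 0 ≤ u i) (hv : ∀ i, 0 ≤ v i) :
    0 ≤ ∑ i : Fin n, u i * (v i - (if _ : i.val = 0 then 0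
      else v ⟨i.val - 1, lt_of_le_of_lt (Nat.sub_le _ _) i.isLt⟩)) := by
  set U : ℕ → ℝ := fun k => if h : k < n then u ⟨k, h⟩ else 0 with hU
  set V : ℕ → ℝ := fun k => if k = 0 then 0
    else if h : k - 1 < n then v ⟨k - 1, h⟩ else 0 with hV
  have hUanti : Antitone U := by
    intro a b hab
    simp only [hU]
    split_ifs with hb ha ha
    · exact hu (Fin.mk_le_mk.2 hab)
    · omega
    · exact hu0 _
    · exact le_rfl
  have hVnonneg : ∀ k, 0 ≤ V k := by
    intro k
    simp only [hV]
    split_ifs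
    exacts [le_rfl, hv _, le_rfl]
  have key := mul_le_sum_mul_sub_of_antitone hUanti hVnonneg (by simp [hV]) n
  have hUn : U n = 0 := by simp [hU]
  rw [hUn, zero_mul, Finset.sum_range] at key
  refine key.trans_eq (Finset.sum_congr rfl fun i _ => ?_)
  have hi : i.val - 1 < n := lt_of_le_of_lt (Nat.sub_le _ _) i.isLt
  simp [hU, hV, hi]

/-- Testing the stationarity equation against a vector of the monotone nonnegative cone. -/
lemma IsKKT.sum_mul_sub_le {n : ℕ} {z w x v u : Fin n → ℝ} {ε lam : ℝ}
    (h : IsKKT z w ε x lam v) (hu : u ∈ coneT n) :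
    ∑ i, u i * z i - lam * ∑ i, u i * w i ≤ ∑ i, u i * x i := by
  obtain ⟨-, hv, -, -, -, hx, -⟩ := h
  have key := sum_mul_sub_pred_nonneg hu.1 hu.2 hv
  rw [Finset.mul_sum, ← Finset.sum_sub_distrib, ← sub_nonneg, ← Finset.sum_sub_distrib]
  refine key.trans_eq (Finset.sum_congr rfl fun i _ => ?_)
  rw [hx i]
  ring

lemma IsKKT.lam1_le {n : ℕ} {z w x v : Fin n → ℝ} {ε lam : ℝ}
    (h : IsKKT z w ε x lam v) (hw : w ∈ coneT n) : lam1 z w ε ≤ lam := by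
  have key := h.sum_mul_sub_le hw
  obtain ⟨hlam, -, -, -, -, -, hε⟩ := h
  refine div_le_of_le_mul₀ (Finset.sum_nonneg fun i _ => mul_self_nonneg _) hlam.le ?_
  have hzw : dot z w = ∑ i, w i * z i := Finset.sum_congr rfl fun i _ => mul_comm _ _
  unfold dot at *
  linarith

lemma IsKKT.lam0_le {n : ℕ} (hn : 0 < n) {z w x v : Fin n → ℝ} {ε lam : ℝ}
    (h : IsKKT z w ε x lam v) (hw : w ∈ coneT n) (hz : Antitone z) :
    lam0 hn z w ε ≤ lam := by
  have hu : (fun i => if z (lastIdx hn) < z i then w i else 0) ∈ coneT n := by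
    refine ⟨fun i j hij => ?_, fun i => ?_⟩
    · dsimp only
      split_ifs with hj hi hi
      · exact hw.1 hij
      · exact absurd (hj.trans_le (hz hij)) hi
      · exact hw.2 i
      · exact le_rfl
    · dsimp only
      split_ifs
      exacts [hw.2 i, le_rfl]
  have key := h.sum_mul_sub_le hu
  obtain ⟨hlam, -, hx, -, -, -, hε⟩ := h
  simp only [ite_mul, zero_mul, ← Finset.sum_filter] at key
  have hle : ∑ i with z (lastIdx hn) < z i, w i * x i ≤ ε := by
    rw [← hε]
    exact Finset.sum_le_sum_of_subset_of_nonneg (Finset.filter_subset _ _)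
      fun i _ _ => mul_nonneg (hw.2 i) (hx.2 i)
  refine div_le_of_le_mul₀ (Finset.sum_nonneg fun i _ => sq_nonneg _) hlam.le ?_
  simp only [sq, mul_comm (z _)]
  linarith

lemma IsKKT.apply_last_eq_zero {n : ℕ} (hn : 0 < n) {z w x v : Fin n → ℝ} {ε lam : ℝ}
    (h : IsKKT z w ε x lam v) (hneg : z (lastIdx hn) - lam * w (lastIdx hn) < 0) :
    x (lastIdx hn) = 0 := by
  obtain ⟨-, hv, hx, -, hlast, hstat, -⟩ := h
  rcases mul_eq_zero.1 (hlast hn) with hv0 | hx0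
  · have hi := hstat (lastIdx hn)
    have hv0 : v (lastIdx hn) = 0 := hv0
    have hnonneg := hx.2 (lastIdx hn)
    split_ifs at hi with h0
    · linarith
    · linarith [hv ⟨(lastIdx hn).val - 1, lt_of_le_of_lt (Nat.sub_le _ _) (lastIdx hn).isLt⟩]
  · exact hx0

/-- Alternative 4. If `λ₁ ≤ r < ∞` and `zₙ − λ₁wₙ < 0`, then
`x*ₙ = 0` and `λ* ≥ λ₀`; in particular if additionally `λ₀ > r` then `λ* ≥ λ₀ > r`. -/
theorem alternative_four {n : ℕ} (hn : 0 < n) (ε : ℝ) (hε : 0 < ε)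
    (w : Fin n → ℝ) (hw_anti : Antitone w) (hw_nonneg : ∀ i, 0 ≤ w i) (hw_ne : w ≠ 0)
    (z : Fin n → ℝ) (hz : z ∈ coneT n) (hw : w ∈ coneT n) (hzw : ε < dot w z)
    (Gz : Finset (Finset (Fin n))) (hGz : IsGroupPartition z Gz) (hwG : IsAvg Gz w w)
    (xs : Fin n → ℝ) (hxs : IsProjOn (hyperplane w ε ∩ coneT n) z xs)
    (lamstar : ℝ) (vstar : Fin n → ℝ) (hKKT : IsKKT z w ε xs lamstar vstar)
    (hr1 : (lam1 z w ε : EReal) ≤ rmin z w) (hr2 : rmin z w < ⊤)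
    (hzn : z (lastIdx hn) - lam1 z w ε * w (lastIdx hn) < 0) :
    xs (lastIdx hn) = 0 ∧ lam0 hn z w ε ≤ lamstar ∧
      (rmin z w < (lam0 hn z w ε : EReal) →
        lam0 hn z w ε ≤ lamstar ∧ rmin z w < (lam0 hn z w ε : EReal)) := by
  have hlast : z (lastIdx hn) - lamstar * w (lastIdx hn) < 0 := by
    linarith [mul_le_mul_of_nonneg_right (hKKT.lam1_le hw) (hw_nonneg (lastIdx hn))]
  have hle := hKKT.lam0_le hn hw hz.1
  exact ⟨hKKT.apply_last_eq_zero hn hlast, hle, fun h => ⟨hle, h⟩⟩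
end

section
/- Assume z, w ∈ T, w ≠ 0, ⟨w, z⟩ > ε, and w = w_{𝒢(z)}. If λ₁ ≤ r < ∞, zₙ − λ₁wₙ < 0, λ₀ ≤ r, and n' ≤ n with z_{n'} = zₙ, then x* = max{z − λ₀w, 0} componentwise, where x* = P_{H(w,ε) ∩ T}(z). -/
open Finset

/-- If `l ≤ rmin z w`, then `z - l • w` is antitone. -/
theorem antitone_sub_of_le_rmin {n : ℕ} {z w : Fin n → ℝ} {l : ℝ} (hz : Antitone z)
    (hw : Antitone w) (hl : (l : EReal) ≤ rmin z w) :
    Antitone fun j => z j - l * w j := by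
  cases n with
  | zero => exact fun i => i.elim0
  | succ m =>
    refine Fin.antitone_iff_succ_le.2 fun i => ?_
    have hzi : z i.succ ≤ z i.castSucc := hz (Fin.castSucc_le_succ i)
    have hwi : w i.succ ≤ w i.castSucc := hw (Fin.castSucc_le_succ i)
    have hlt : i.castSucc.val + 1 < m + 1 := Nat.succ_lt_succ i.isLt
    have hsucc : (⟨i.castSucc.val + 1, hlt⟩ : Fin (m + 1)) = i.succ := rfl
    have hli := hl.trans (iInf_le _ i.castSucc)
    rw [dif_pos hlt, hsucc] at hli
    split_ifs at hli with h0
    · have : w i.castSucc = w i.succ := sub_eq_zero.1 h0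
      simp only [this]
      linarith
    · rw [EReal.coe_le_coe_iff,
        le_div_iff₀ (lt_of_le_of_ne (sub_nonneg.2 hwi) (Ne.symm h0))] at hli
      linarith

/-- The point `max (z - l • w) 0` is the only possible projection of `z` onto a set of nonnegative
vectors contained in a hyperplane with normal `w`. -/
theorem IsProjOn.eq_max_of_mem {n : ℕ} {C : Set (Fin n → ℝ)} {w z x : Fin n → ℝ} {ε l : ℝ}
    (hx : IsProjOn C z x) (hC : C ⊆ hyperplane w ε) (hnonneg : ∀ y ∈ C, ∀ i, 0 ≤ y i)
    (hmem : (fun j => max (z j - l * w j) 0) ∈ C) :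
    x = fun j => max (z j - l * w j) 0 := by
  set p : Fin n → ℝ := fun j => max (z j - l * w j) 0 with hp
  have hterm : ∀ j, (x j - p j) ^ 2 + (p j - z j) ^ 2 + 2 * l * (w j * p j - w j * x j)
      ≤ (x j - z j) ^ 2 := fun j => by
    have hxj := hnonneg x hx.1 j
    rcases le_total (z j - l * w j) 0 with h | h
    · have : p j = 0 := max_eq_right h
      rw [this]
      nlinarith
    · have : p j = z j - l * w j := max_eq_left h
      rw [this]
      nlinarith
  have hsum := sum_le_sum fun j (_ : j ∈ univ) => hterm j
  have hwx : ∑ j, w j * x j = ε := hC hx.1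
  have hwp : ∑ j, w j * p j = ε := hC hmem
  simp only [sum_add_distrib, ← mul_sum, sum_sub_distrib, hwx, hwp] at hsum
  have hle : ∑ j, (x j - p j) ^ 2 ≤ 0 := by linarith [hx.2 p hmem]
  have hzero := (sum_eq_zero_iff_of_nonneg fun j _ => sq_nonneg (x j - p j)).1
    (le_antisymm hle (sum_nonneg fun j _ => sq_nonneg _))
  funext j
  exact sub_eq_zero.1 (pow_eq_zero_iff two_ne_zero |>.1 (hzero j (mem_univ j)))

/-- The index attaining `nprime` is the first one at which `z - l • w` is negative. -/
theorem neg_and_nonneg_of_eq_nprime {n : ℕ} {z w : Fin n → ℝ} {l : ℝ} {i : Fin n}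
    (hi : (i : ℕ) + 1 = nprime z w l) :
    z i - l * w i < 0 ∧ ∀ j < i, 0 ≤ z j - l * w j := by
  have hmem : nprime z w l ∈
      {k | k = n + 1 ∨ ∃ i : Fin n, i.val + 1 = k ∧ z i - l * w i < 0} :=
    Nat.sInf_mem ⟨n + 1, Or.inl rfl⟩
  rw [← hi] at hmem
  constructor
  · rcases hmem with h | ⟨j, hj, hneg⟩
    · exact absurd h (by omega)
    · obtain rfl : j = i := Fin.ext (by omega)
      exact hneg
  · intro j hj
    by_contra! hneg
    have : nprime z w l ≤ j + 1 := Nat.sInf_le (Or.inr ⟨j, rfl, hneg⟩)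
    have : (j : ℕ) < i := hj
    omega

/-- Alternative 5. If `λ₁ ≤ r < ∞`, `zₙ − λ₁wₙ < 0`, `λ₀ ≤ r`, and
`n' ≤ n` with `z_{n'} = zₙ`, then `x* = max{z − λ₀w, 0}` componentwise. The condition
`n' ≤ n` with `z_{n'} = zₙ` is expressed by the witness `i : Fin n` with `i + 1 = n'`. -/
theorem alternative_five {n : ℕ} (hn : 0 < n) (ε : ℝ) (hε : 0 < ε)
    (w : Fin n → ℝ) (hw_anti : Antitone w) (hw_nonneg : ∀ i, 0 ≤ w i) (hw_ne : w ≠ 0)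
    (z : Fin n → ℝ) (hz : z ∈ coneT n) (hw : w ∈ coneT n) (hzw : ε < dot w z)
    (Gz : Finset (Finset (Fin n))) (hGz : IsGroupPartition z Gz) (hwG : IsAvg Gz w w)
    (hr1 : (lam1 z w ε : EReal) ≤ rmin z w) (hr2 : rmin z w < ⊤)
    (hzn : z (lastIdx hn) - lam1 z w ε * w (lastIdx hn) < 0)
    (hl0r : (lam0 hn z w ε : EReal) ≤ rmin z w)
    (hnp : ∃ i : Fin n, (i : ℕ) + 1 = nprime z w (lam0 hn z w ε) ∧ z i = z (lastIdx hn))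
    (xs : Fin n → ℝ) (hxs : IsProjOn (hyperplane w ε ∩ coneT n) z xs) :
    xs = fun j => max (z j - lam0 hn z w ε * w j) 0 := by
  obtain ⟨i, hi, hzi⟩ := hnp
  obtain ⟨hneg, hbefore⟩ := neg_and_nonneg_of_eq_nprime hi
  have hanti := antitone_sub_of_le_rmin hz.1 hw_anti hl0r
  set l := lam0 hn z w ε with hl
  have hlpos : 0 < l := by
    by_contra! hle
    nlinarith [hz.2 i, hw_nonneg i]
  have hlast : ∀ j, z (lastIdx hn) ≤ z j := fun j => hz.1 (Nat.le_sub_one_of_lt j.isLt)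
  have hmax_upper : ∀ j, z (lastIdx hn) < z j → max (z j - l * w j) 0 = z j - l * w j :=
    fun j hj => max_eq_left (hbefore j (lt_of_not_ge fun hij => (hz.1 hij).not_gt (hzi ▸ hj)))
  have hmax_lower : ∀ j, ¬ z (lastIdx hn) < z j → max (z j - l * w j) 0 = 0 := by
    refine fun j hj => max_eq_right ?_
    rcases le_total i j with hij | hji
    · exact (hanti hij).trans hneg.le
    · have := mul_le_mul_of_nonneg_left (hw_anti hji) hlpos.le
      linarith [hlast j]
  have hden : ∑ j ∈ univ.filter (fun j => z (lastIdx hn) < z j), w j ^ 2 ≠ 0 := fun h0 =>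
    hlpos.ne' (by rw [hl, lam0, h0, div_zero])
  have hdot : dot w (fun j => max (z j - l * w j) 0) = ε := by
    have hterm : ∀ j, w j * max (z j - l * w j) 0 =
        if z (lastIdx hn) < z j then z j * w j - l * w j ^ 2 else 0 := fun j => by
      split_ifs with hj
      · rw [hmax_upper j hj]
        ring
      · rw [hmax_lower j hj, mul_zero]
    have hmul := div_mul_cancel₀
      ((∑ j ∈ univ.filter (fun j => z (lastIdx hn) < z j), z j * w j) - ε) hden
    change l * _ = _ at hmul
    simp only [dot, hterm]
    rw [← sum_filter, sum_sub_distrib, ← mul_sum, hmul]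
    ring
  exact hxs.eq_max_of_mem Set.inter_subset_left (fun y hy => hy.2.2)
    ⟨hdot, fun a b hab => max_le_max_right 0 (hanti hab), fun j => le_max_right _ _⟩
end
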